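/- arXiv:math/0302048 — 2 statements merged into one kernel-verified Lean document; each statement's English description precedes it below -/
import Mathlib

section
/- Let R be a reduced irreducible root system with base Π, and let k = |𝒦(Π)| be the cardinality of the cascade. Then: for type A_ℓ (ℓ ≥ 1), k = ⌊(ℓ+1)/2⌋; for type B_ℓ (ℓ ≥ 2), k = ℓ; for type C_ℓ (ℓ ≥ 3), k = ℓ; for type D_ℓ (ℓ ≥ 4), k = 2⌊ℓ/2⌋; for type E_6, k = 4; for type E_7, k = 7; for type E_8, k = 8; for type F_4, k = 4; for type G_2, k = 2. -/
open Finset Module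

open scoped Classical

/-- A reduced crystallographic root system in the `k`-vector space `V`, recorded through
the finite set `roots` of roots, the coroot linear forms `corootForm α = ⟨·, α^∨⟩`, and
the integer Cartan pairing `pairInt β α = ⟨β, α^∨⟩ ∈ ℤ` (meaningful when `α, β` are roots). -/
structure RootSystemData (k V : Type*) [Field k] [CharZero k]
    [AddCommGroup V] [Module k V] where
  /-- the (finite) set of roots -/
  roots : Finset V
  /-- `corootForm α` is the linear form `⟨·, α^∨⟩` associated to the coroot of a root `α` -/
  corootForm : V → V →ₗ[k] k
  /-- the integer `⟨β, α^∨⟩`, recorded as `pairInt β α` -/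
  pairInt : V → V → ℤ
  ne_zero : ∀ α ∈ roots, α ≠ (0 : V)
  span_eq_top : Submodule.span k (roots : Set V) = ⊤
  pair_compat : ∀ α ∈ roots, ∀ β ∈ roots, ((pairInt β α : ℤ) : k) = corootForm α β
  pair_self : ∀ α ∈ roots, pairInt α α = 2
  reflect_mem : ∀ α ∈ roots, ∀ β ∈ roots, β - pairInt β α • α ∈ roots
  reduced : ∀ α ∈ roots, ∀ c : k, c • α ∈ roots → c = 1 ∨ c = -1

namespace RootSystemData

variable {k V : Type*} [Field k] [CharZero k] [AddCommGroup V] [Module k V]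
variable (P : RootSystemData k V)

/-- A base (set of simple roots) of the root system: a linearly independent set of roots
such that every root is a nonnegative or nonpositive integral combination of its elements. -/
structure IsBase (B : Finset V) : Prop where
  subset : B ⊆ P.roots
  indep : LinearIndependent k (fun b : B => (b : V))
  pos_or_neg : ∀ α ∈ P.roots,
    α ∈ AddSubmonoid.closure (B : Set V) ∨ -α ∈ AddSubmonoid.closure (B : Set V)

/-- The positive roots `R₊` with respect to a base `B`. -/
noncomputable def posRoots (B : Finset V) : Finset V :=
  P.roots.filter fun α => α ∈ AddSubmonoid.closure (B : Set V)

/-- `R^S = R ∩ ℤS`. -/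
noncomputable def rootsOf (S : Finset V) : Finset V :=
  P.roots.filter fun α => α ∈ AddSubgroup.closure (S : Set V)

/-- `R₊^S = R ∩ ℕS`. -/
noncomputable def posRootsOf (S : Finset V) : Finset V :=
  P.roots.filter fun α => α ∈ AddSubmonoid.closure (S : Set V)

/-- Two simple roots are linked in the Dynkin diagram of `S ⊆ Π` when they can be joined
by a chain in `S` of consecutively non-orthogonal elements. -/
def Linked (S : Finset V) : V → V → Prop :=
  Relation.ReflTransGen fun a b => a ∈ S ∧ b ∈ S ∧ P.pairInt a b ≠ 0

/-- A subset of a base is connected if its Dynkin diagram is connected (and nonempty). -/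
def IsConnected (S : Finset V) : Prop :=
  S.Nonempty ∧ ∀ a ∈ S, ∀ b ∈ S, P.Linked S a b

/-- `ε` is the highest root of `R^S`: a positive root of `R^S` such that `ε - α ∈ ℕS`
for every root `α ∈ R^S`. -/
def IsHighestRoot (S : Finset V) (ε : V) : Prop :=
  ε ∈ P.posRootsOf S ∧ ∀ α ∈ P.rootsOf S, ε - α ∈ AddSubmonoid.closure (S : Set V)

/-- The highest root `ε_S` of `R^S` (junk value `0` if it does not exist). -/
noncomputable def highestRoot (S : Finset V) : V :=
  if h : ∃ ε, P.IsHighestRoot S ε then h.choose else 0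

/-- The connected component of `a` in the Dynkin diagram of `S`. -/
noncomputable def component (S : Finset V) (a : V) : Finset V :=
  S.filter fun b => P.Linked S a b

/-- The connected components of the Dynkin diagram of `S`. -/
noncomputable def components (S : Finset V) : Finset (Finset V) :=
  S.image fun a => P.component S a

/-- `{α ∈ S : ⟨α, ε_S^∨⟩ = 0}`. -/
noncomputable def zeroPart (S : Finset V) : Finset V :=
  S.filter fun a => P.pairInt a (P.highestRoot S) = 0

/-- Fuel-based auxiliary recursion for the cascade `𝒦(S)`; for an actual root system the
recursion terminates in at most `card S` steps, so fuel `card S + 1` computes `𝒦(S)`. -/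
noncomputable def cascadeAux : ℕ → Finset V → Finset (Finset V)
  | 0, _ => ∅
  | n + 1, S => (P.components S).biUnion fun C => insert C (cascadeAux n (P.zeroPart C))

/-- The cascade `𝒦(S)`, defined recursively by `𝒦(∅) = ∅`,
`𝒦(S) = 𝒦(S₁) ∪ ⋯ ∪ 𝒦(S_r)` if `S` has connected components `S₁, …, S_r`, and
`𝒦(S) = {S} ∪ 𝒦({α ∈ S : ⟨α, ε_S^∨⟩ = 0})` if `S` is connected. -/
noncomputable def cascade (S : Finset V) : Finset (Finset V) :=
  P.cascadeAux (S.card + 1) S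

/-- `Γ^K = {α ∈ R^K : ⟨α, ε_K^∨⟩ > 0}`. -/
noncomputable def gamma (K : Finset V) : Finset V :=
  (P.rootsOf K).filter fun α => 0 < P.pairInt α (P.highestRoot K)

end RootSystemData

variable {k V : Type*} [Field k] [CharZero k] [AddCommGroup V] [Module k V]

/-- The Cartan matrix of type `A_ℓ` (Bourbaki numbering, 0-indexed):
`⟨α_i, α_j^∨⟩` for simple roots along a chain. -/
def cartanA (l : ℕ) : Fin l → Fin l → ℤ := fun i j =>
  if (i : ℕ) = j then 2
  else if (i : ℕ) + 1 = j ∨ (j : ℕ) + 1 = i then -1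
  else 0

/-- The Cartan matrix of type `B_l` (Bourbaki numbering, 0-indexed; the last simple root is
short, so `⟨α_{l-1}, α_l^∨⟩ = -2`). -/
def cartanB (l : ℕ) : Fin l → Fin l → ℤ := fun i j =>
  if (i : ℕ) = j then 2
  else if (i : ℕ) + 1 = j then (if (j : ℕ) = l - 1 then -2 else -1)
  else if (j : ℕ) + 1 = i then -1
  else 0

/-- The Cartan matrix of type `C_l` (transpose of that of `B_l`). -/
def cartanC (l : ℕ) : Fin l → Fin l → ℤ := fun i j => cartanB l j i

/-- The Cartan matrix of type `D_l` (Bourbaki numbering, 0-indexed: a chain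
`α_0, …, α_{l-2}` with the extra node `α_{l-1}` attached to `α_{l-3}`). -/
def cartanD (l : ℕ) : Fin l → Fin l → ℤ := fun i j =>
  if (i : ℕ) = j then 2
  else if ((i : ℕ) + 1 = j ∧ (j : ℕ) ≤ l - 2) ∨ ((j : ℕ) + 1 = i ∧ (i : ℕ) ≤ l - 2) ∨
      ((i : ℕ) = l - 3 ∧ (j : ℕ) = l - 1) ∨ ((j : ℕ) = l - 3 ∧ (i : ℕ) = l - 1) then -1
  else 0

/-- The Cartan matrix of type `E_n` for `n = 6, 7, 8` (Bourbaki numbering, 0-indexed: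
a chain `α_0, α_2, α_3, α_4, …, α_{n-1}` with the node `α_1` attached to `α_3`). -/
def cartanE (n : ℕ) : Fin n → Fin n → ℤ := fun i j =>
  if (i : ℕ) = j then 2
  else if ((i : ℕ) = 0 ∧ (j : ℕ) = 2) ∨ ((j : ℕ) = 0 ∧ (i : ℕ) = 2) ∨
      ((i : ℕ) = 1 ∧ (j : ℕ) = 3) ∨ ((j : ℕ) = 1 ∧ (i : ℕ) = 3) ∨
      (2 ≤ (i : ℕ) ∧ (i : ℕ) + 1 = j) ∨ (2 ≤ (j : ℕ) ∧ (j : ℕ) + 1 = i) then -1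
  else 0

/-- The Cartan matrix of type `F_4` (Bourbaki numbering, 0-indexed;
`⟨α_1, α_2^∨⟩ = -2`). -/
def cartanF : Fin 4 → Fin 4 → ℤ := fun i j =>
  if (i : ℕ) = j then 2
  else if ((i : ℕ) = 0 ∧ (j : ℕ) = 1) ∨ ((j : ℕ) = 0 ∧ (i : ℕ) = 1) ∨
      ((i : ℕ) = 2 ∧ (j : ℕ) = 3) ∨ ((j : ℕ) = 2 ∧ (i : ℕ) = 3) ∨
      ((i : ℕ) = 2 ∧ (j : ℕ) = 1) then -1
  else if (i : ℕ) = 1 ∧ (j : ℕ) = 2 then -2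
  else 0

/-- The Cartan matrix of type `G_2`. -/
def cartanG : Fin 2 → Fin 2 → ℤ := fun i j =>
  if (i : ℕ) = j then 2 else if (i : ℕ) = 0 then -1 else -3

/-- The root system `P` (with base `Δ`) has the type given by the `n × n` Cartan matrix `A`:
the elements of `Δ` can be enumerated as `e 0, …, e (n-1)` with `⟨e i, (e j)^∨⟩ = A i j`. -/
def RootSystemData.HasCartanType (P : RootSystemData k V) {n : ℕ}
    (A : Fin n → Fin n → ℤ) (Δ : Finset V) : Prop :=
  ∃ e : Fin n → V, Function.Injective e ∧ Finset.image e Finset.univ = Δ ∧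
    ∀ i j, P.pairInt (e i) (e j) = A i j

namespace RootSystemData

section found

variable (P : RootSystemData k V)

lemma neg_root {α : V} (h : α ∈ P.roots) : -α ∈ P.roots := by
  have := P.reflect_mem α h α h
  rw [P.pair_self α h, two_zsmul] at this
  simpa using this

lemma pair_refl_left {α β γ : V} (ha : α ∈ P.roots) (hb : β ∈ P.roots) (hc : γ ∈ P.roots) :
    P.pairInt (β - P.pairInt β α • α) γ = P.pairInt β γ - P.pairInt β α * P.pairInt α γ := by
  have h := P.pair_compat γ hc _ (P.reflect_mem α ha β hb)
  rw [map_sub, map_zsmul, ← P.pair_compat γ hc β hb, ← P.pair_compat γ hc α ha] at h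
  rw [zsmul_eq_mul] at h
  exact_mod_cast h

/-- the coroot of a reflected root -/
lemma pair_refl_right {α β γ : V} (ha : α ∈ P.roots) (hb : β ∈ P.roots) (hc : γ ∈ P.roots) :
    P.pairInt γ (β - P.pairInt β α • α) = P.pairInt (γ - P.pairInt γ α • α) β := by
  set δ := β - P.pairInt β α • α with hδ
  have hd : δ ∈ P.roots := P.reflect_mem α ha β hb
  let s : V →ₗ[k] V := preReflection α (P.corootForm α)
  have hs : ∀ x ∈ P.roots, s x = x - P.pairInt x α • α := by
    intro x hx
    simp only [s, preReflection_apply]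
    rw [← P.pair_compat α ha x hx, Int.cast_smul_eq_zsmul]
  have hss : ∀ x, s (s x) = x := by
    intro x
    have h2 : P.corootForm α α = 2 := by
      rw [← P.pair_compat α ha α ha, P.pair_self α ha]; norm_num
    simp only [s, preReflection_apply, map_sub, map_smul, h2]
    module
  have hsm : ∀ x ∈ P.roots, s x ∈ P.roots := fun x hx => by
    rw [hs x hx]; exact P.reflect_mem α ha x hx
  have hsb : s β = δ := hs β hb
  have hsd : s δ = β := by rw [← hsb, hss]
  have key : P.corootForm δ = (P.corootForm β).comp s := by
    apply Dual.eq_of_preReflection_mapsTo (x := δ) (Φ := (P.roots : Set V))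
      P.roots.finite_toSet P.span_eq_top
    · rw [← P.pair_compat δ hd δ hd, P.pair_self δ hd]; norm_num
    · intro x hx
      have hx' : x ∈ P.roots := hx
      simp only [preReflection_apply]
      rw [← P.pair_compat δ hd x hx', Int.cast_smul_eq_zsmul]
      exact P.reflect_mem δ hd x hx'
    · simp only [LinearMap.comp_apply]
      rw [hsd, ← P.pair_compat β hb β hb, P.pair_self β hb]; norm_num
    · intro x hx
      have hx' : x ∈ P.roots := hx
      have h1 := hsm x hx'
      have h2 := hsm _ (P.reflect_mem β hb (s x) h1)
      simp only [preReflection_apply, LinearMap.comp_apply]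
      rw [map_sub, map_zsmul, hss, hsb] at h2
      rw [← P.pair_compat β hb _ h1, Int.cast_smul_eq_zsmul]
      exact h2
  have h3 := P.pair_compat δ hd γ hc
  rw [key, LinearMap.comp_apply, ← P.pair_compat β hb _ (hsm γ hc), hs γ hc] at h3
  exact_mod_cast h3

/-- the canonical invariant form on roots -/
noncomputable def nf (x y : V) : ℤ := ∑ α ∈ P.roots, P.pairInt x α * P.pairInt y α

lemma nf_comm (x y : V) : P.nf x y = P.nf y x := by
  unfold nf; exact Finset.sum_congr rfl fun _ _ => mul_comm _ _

lemma nf_self_pos {x : V} (hx : x ∈ P.roots) : 0 < P.nf x x := by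
  unfold nf
  apply Finset.sum_pos'
  · intro i _; exact mul_self_nonneg _
  · exact ⟨x, hx, by rw [P.pair_self x hx]; norm_num⟩

lemma nf_refl {α β γ : V} (ha : α ∈ P.roots) (hb : β ∈ P.roots) (hc : γ ∈ P.roots) :
    P.nf (β - P.pairInt β α • α) (γ - P.pairInt γ α • α) = P.nf β γ := by
  unfold nf
  have inv : ∀ x ∈ P.roots, (x - P.pairInt x α • α) -
      P.pairInt (x - P.pairInt x α • α) α • α = x := by
    intro x hx
    rw [P.pair_refl_left ha hx ha, P.pair_self α ha]
    module
  refine Finset.sum_bij' (fun x _ => x - P.pairInt x α • α) (fun x _ => x - P.pairInt x α • α)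
    (fun x hx => P.reflect_mem α ha x hx) (fun x hx => P.reflect_mem α ha x hx)
    inv inv ?_
  intro x hx
  rw [P.pair_refl_right ha hx hb, P.pair_refl_right ha hx hc]

lemma nf_sub_zsmul {α β γ δ : V} (ha : α ∈ P.roots) (hb : β ∈ P.roots) (hd : δ ∈ P.roots) (n : ℤ)
    (h : δ = β - n • α) : P.nf δ γ = P.nf β γ - n * P.nf α γ := by
  unfold nf
  rw [Finset.mul_sum, ← Finset.sum_sub_distrib]
  refine Finset.sum_congr rfl fun x hx => ?_
  have h1 := P.pair_compat x hx δ hd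
  rw [h, map_sub, map_zsmul, ← P.pair_compat x hx β hb, ← P.pair_compat x hx α ha,
    zsmul_eq_mul, ← h] at h1
  have h2 : P.pairInt δ x = P.pairInt β x - n * P.pairInt α x := by exact_mod_cast h1
  rw [h2]; ring

lemma pair_mul_nf {α β : V} (ha : α ∈ P.roots) (hb : β ∈ P.roots) :
    P.pairInt β α * P.nf α α = 2 * P.nf β α := by
  have h := P.nf_refl ha hb ha
  rw [P.nf_sub_zsmul ha hb (P.reflect_mem α ha β hb) _ rfl, P.nf_comm β,
    P.nf_comm α (α - _), P.nf_sub_zsmul ha ha (P.reflect_mem α ha α ha) _ rfl,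
    P.nf_sub_zsmul ha ha (P.reflect_mem α ha α ha) _ rfl, P.pair_self α ha, P.nf_comm α β] at h
  have h' : P.nf (α - (2:ℤ) • α) β = - P.nf α β := by
    rw [P.nf_sub_zsmul (β := α) ha ha ?_ 2 rfl]
    · ring
    · have := P.neg_root ha
      convert this using 1
      module
  nlinarith [h, h', P.nf_comm α β]

lemma pair_zero_symm {α β : V} (ha : α ∈ P.roots) (hb : β ∈ P.roots) :
    P.pairInt β α = 0 ↔ P.pairInt α β = 0 := by
  have h1 := P.pair_mul_nf ha hb
  have h2 := P.pair_mul_nf hb ha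
  have h3 := P.nf_self_pos ha
  have h4 := P.nf_self_pos hb
  have h5 := P.nf_comm α β
  constructor
  · intro h
    rw [h] at h1
    have : P.pairInt α β * P.nf β β = 0 := by linarith
    rcases mul_eq_zero.1 this with h | h
    · exact h
    · omega
  · intro h
    rw [h] at h2
    have : P.pairInt β α * P.nf α α = 0 := by linarith
    rcases mul_eq_zero.1 this with h | h
    · exact h
    · omega

lemma pair_pos_iff {α β : V} (ha : α ∈ P.roots) (hb : β ∈ P.roots) :
    0 < P.pairInt β α ↔ 0 < P.nf β α := by
  have h1 := P.pair_mul_nf ha hb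
  have h3 := P.nf_self_pos ha
  constructor
  · intro h
    have := mul_pos h h3
    omega
  · intro h
    by_contra hc
    have := mul_nonpos_of_nonpos_of_nonneg (not_lt.1 hc) h3.le
    omega

lemma pair_nonneg_iff {α β : V} (ha : α ∈ P.roots) (hb : β ∈ P.roots) :
    0 ≤ P.pairInt β α ↔ 0 ≤ P.nf β α := by
  have h1 := P.pair_mul_nf ha hb
  have h3 := P.nf_self_pos ha
  constructor
  · intro h
    have := mul_nonneg h h3.le
    omega
  · intro h
    by_contra hc
    have := mul_neg_of_neg_of_pos (not_le.1 hc) h3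
    omega

lemma nf_cauchy (x y : V) : P.nf x y ^ 2 ≤ P.nf x x * P.nf y y := by
  unfold nf
  have := Finset.sum_mul_sq_le_sq_mul_sq P.roots (fun α => P.pairInt x α) (fun α => P.pairInt y α)
  simpa [pow_two] using this

/-- two roots with the same pairings are equal -/
lemma eq_of_pair_eq {β θ : V} (hb : β ∈ P.roots) (ht : θ ∈ P.roots)
    (h : ∀ α ∈ P.roots, P.pairInt β α = P.pairInt θ α) : β = θ := by
  by_contra hne
  have hv : β - θ ≠ 0 := sub_ne_zero.2 hne
  have hz : ∀ α ∈ P.roots, P.corootForm α (β - θ) = 0 := by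
    intro α ha
    rw [map_sub, ← P.pair_compat α ha β hb, ← P.pair_compat α ha θ ht, h α ha, sub_self]
  have hall : ∀ n : ℕ, θ + n • (β - θ) ∈ P.roots ∧ θ + (n + 1) • (β - θ) ∈ P.roots := by
    intro n
    induction n with
    | zero => simpa using ⟨ht, hb⟩
    | succ n ih =>
      refine ⟨ih.2, ?_⟩
      have h1 := P.reflect_mem _ ih.2 _ ih.1
      have h2 : P.pairInt (θ + n • (β - θ)) (θ + (n + 1) • (β - θ)) = 2 := by
        have e1 := P.pair_compat _ ih.2 _ ih.1
        have e2 := P.pair_compat _ ih.2 _ ih.2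
        rw [P.pair_self _ ih.2] at e2
        have : P.corootForm (θ + (n + 1) • (β - θ)) (θ + n • (β - θ)) =
            P.corootForm (θ + (n + 1) • (β - θ)) (θ + (n + 1) • (β - θ)) := by
          generalize hX : P.corootForm (θ + (n + 1) • (β - θ)) = X
          have hz' := hz _ ih.2
          rw [hX] at hz'
          rw [map_add, map_add, map_nsmul, map_nsmul, hz']
          simp
        rw [this, ← e2] at e1
        exact_mod_cast e1
      rw [h2] at h1
      have h3 := P.neg_root h1
      convert h3 using 1
      module
  have hinj : Function.Injective (fun n : ℕ => θ + n • (β - θ)) := by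
    intro a b hab
    have h1 : (a : k) • (β - θ) = (b : k) • (β - θ) := by
      rw [Nat.cast_smul_eq_nsmul, Nat.cast_smul_eq_nsmul]
      exact add_left_cancel hab
    exact_mod_cast smul_left_injective k hv h1
  exact Set.infinite_of_injective_forall_mem hinj (fun n => (hall n).1)
    (P.roots.finite_toSet)

lemma sub_mem_of_pos {β θ : V} (hb : β ∈ P.roots) (ht : θ ∈ P.roots)
    (hN : P.nf β β ≤ P.nf θ θ) (hp : 0 < P.pairInt β θ) (hne : β ≠ θ) : β - θ ∈ P.roots := by
  have h1 := P.pair_mul_nf ht hb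
  have h2 := P.nf_cauchy β θ
  have h3 := P.nf_self_pos ht
  have h4 := P.nf_self_pos hb
  have h5 : P.nf β θ ≤ P.nf θ θ := by
    by_contra hc
    push Not at hc
    nlinarith
  have h6 : P.pairInt β θ ≤ 2 := by
    by_contra hc
    push Not at hc
    nlinarith
  have h7 : P.pairInt β θ = 1 ∨ P.pairInt β θ = 2 := by omega
  rcases h7 with h | h
  · have := P.reflect_mem θ ht β hb
    rwa [h, one_smul] at this
  · exfalso
    apply hne
    rw [h] at h1
    have h8 : P.nf β θ = P.nf θ θ := by linarith
    have h9 : ∑ α ∈ P.roots, (P.pairInt β α - P.pairInt θ α) ^ 2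
        = P.nf β β - 2 * P.nf β θ + P.nf θ θ := by
      unfold nf
      rw [Finset.mul_sum, ← Finset.sum_sub_distrib, ← Finset.sum_add_distrib]
      exact Finset.sum_congr rfl fun x _ => by ring
    have h10 : ∑ α ∈ P.roots, (P.pairInt β α - P.pairInt θ α) ^ 2 = 0 :=
      le_antisymm (by linarith) (Finset.sum_nonneg fun _ _ => sq_nonneg _)
    rw [Finset.sum_eq_zero_iff_of_nonneg (fun _ _ => sq_nonneg _)] at h10
    exact P.eq_of_pair_eq hb ht fun α ha => by
      have := pow_eq_zero_iff (two_ne_zero) |>.1 (h10 α ha)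
      linarith

end found

end RootSystemData

namespace RootSystemData

section coord

variable {m : ℕ}

/-- integral combination of a family -/
def vv (e : Fin m → V) (x : Fin m → ℤ) : V := ∑ i, x i • e i

lemma vv_sub (e : Fin m → V) (x y : Fin m → ℤ) : vv e (x - y) = vv e x - vv e y := by
  simp [vv, sub_smul, Finset.sum_sub_distrib]

lemma vv_neg (e : Fin m → V) (x : Fin m → ℤ) : vv e (-x) = - vv e x := by
  simp [vv]

lemma vv_single (e : Fin m → V) (i : Fin m) (n : ℤ) :
    vv e (fun j => if j = i then n else 0) = n • e i := by
  simp [vv, ite_smul]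

lemma vv_mem_closure (e : Fin m → V) {S : Finset V} (hS : ∀ i, e i ∈ S) {x : Fin m → ℤ}
    (hx : 0 ≤ x) : vv e x ∈ AddSubmonoid.closure (S : Set V) := by
  refine AddSubmonoid.sum_mem _ fun i _ => ?_
  obtain ⟨n, hn⟩ := Int.eq_ofNat_of_zero_le (hx i)
  rw [hn, natCast_zsmul]
  exact AddSubmonoid.nsmul_mem _ (AddSubmonoid.subset_closure (hS i)) _

lemma exists_vv (e : Fin m → V) {S : Finset V} (hS : Finset.image e Finset.univ = S) {β : V}
    (h : β ∈ AddSubgroup.closure (S : Set V)) : ∃ x, β = vv e x := by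
  induction h using AddSubgroup.closure_induction with
  | mem x hx =>
    rw [← hS] at hx
    simp only [Finset.coe_image, Finset.coe_univ, Set.image_univ, Set.mem_range] at hx
    obtain ⟨i, rfl⟩ := hx
    exact ⟨_, by rw [vv_single e i 1, one_smul]⟩
  | zero => exact ⟨0, by simp [vv]⟩
  | add x y _ _ hx hy =>
    obtain ⟨a, rfl⟩ := hx
    obtain ⟨b, rfl⟩ := hy
    exact ⟨a + b, by simp [vv, add_smul, Finset.sum_add_distrib]⟩
  | neg x _ hx =>
    obtain ⟨a, rfl⟩ := hx
    exact ⟨-a, by rw [vv_neg]⟩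

variable (P : RootSystemData k V) {Δ : Finset V} (hbase : P.IsBase Δ)
  (e : Fin m → V) (he : Function.Injective e) (heD : ∀ i, e i ∈ Δ)

include hbase he heD

lemma exists_coord : ∃ f : Fin m → (V →ₗ[k] k), (∀ i x, f i (vv e x) = (x i : k)) ∧
    ∀ i, ∀ α ∈ AddSubmonoid.closure (Δ : Set V), ∃ n : ℕ, f i α = n := by
  have hsp : ⊤ ≤ Submodule.span k (Set.range (fun b : Δ => (b : V))) := by
    rw [← P.span_eq_top, Submodule.span_le]
    have hcl : ∀ α ∈ AddSubmonoid.closure (Δ : Set V),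
        α ∈ Submodule.span k (Set.range (fun b : Δ => (b : V))) := by
      intro α hα
      induction hα using AddSubmonoid.closure_induction with
      | mem x hx => exact Submodule.subset_span ⟨⟨x, hx⟩, rfl⟩
      | zero => exact Submodule.zero_mem _
      | add x y _ _ hx hy => exact Submodule.add_mem _ hx hy
    intro α hα
    rcases hbase.pos_or_neg α hα with h | h
    · exact hcl _ h
    · simpa using Submodule.neg_mem _ (hcl _ h)
  let b := Basis.mk hbase.indep hsp
  have hb : ∀ i j : Δ, b.coord i (j : V) = if j = i then 1 else 0 := by
    intro i j
    have : (j : V) = b j := by simp [b]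
    rw [this, Basis.coord_apply, Basis.repr_self, Finsupp.single_apply]
  refine ⟨fun i => b.coord ⟨e i, heD i⟩, ?_, ?_⟩
  · intro i x
    rw [vv, map_sum, Finset.sum_eq_single i]
    · have := hb ⟨e i, heD i⟩ ⟨e i, heD i⟩
      rw [map_zsmul]
      simp only [if_true] at this
      rw [this]; simp
    · intro j _ hj
      have := hb ⟨e i, heD i⟩ ⟨e j, heD j⟩
      rw [if_neg (by simpa using fun h => hj (he h))] at this
      rw [map_zsmul]
      simp only at this
      rw [this, smul_zero]
    · simp
  · intro i α hα
    induction hα using AddSubmonoid.closure_induction with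
    | mem x hx =>
      have := hb ⟨e i, heD i⟩ ⟨x, hx⟩
      simp only at this
      rw [this]
      split_ifs
      · exact ⟨1, by simp⟩
      · exact ⟨0, by simp⟩
    | zero => exact ⟨0, by simp⟩
    | add x y _ _ hx hy =>
      obtain ⟨a, ha⟩ := hx
      obtain ⟨c, hc⟩ := hy
      exact ⟨a + c, by rw [map_add, ha, hc]; simp⟩

lemma vv_inj : Function.Injective (vv e) := by
  obtain ⟨f, hf, -⟩ := P.exists_coord hbase e he heD
  intro x y h
  funext i
  have := hf i x
  rw [h, hf i y] at this
  exact_mod_cast this.symm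

lemma nonneg_of_closure {x : Fin m → ℤ} (h : vv e x ∈ AddSubmonoid.closure (Δ : Set V)) :
    0 ≤ x := by
  obtain ⟨f, hf, hn⟩ := P.exists_coord hbase e he heD
  intro i
  obtain ⟨n, hn⟩ := hn i _ h
  rw [hf] at hn
  have : x i = n := by exact_mod_cast hn
  rw [this]; simp

lemma vv_pos_or_neg {x : Fin m → ℤ} (h : vv e x ∈ P.roots) : 0 ≤ x ∨ x ≤ 0 := by
  rcases hbase.pos_or_neg _ h with h | h
  · exact Or.inl (P.nonneg_of_closure hbase e he heD h)
  · rw [← vv_neg] at h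
    have := P.nonneg_of_closure hbase e he heD h
    right
    simpa using this

omit hbase he heD in
lemma pair_vv (heR : ∀ i, e i ∈ P.roots) {x : Fin m → ℤ} (h : vv e x ∈ P.roots) {γ : V}
    (hc : γ ∈ P.roots) : P.pairInt (vv e x) γ = ∑ i, x i * P.pairInt (e i) γ := by
  have h1 := P.pair_compat γ hc _ h
  rw [vv, map_sum] at h1
  have h2 : ∀ i, P.corootForm γ (x i • e i) = ((x i * P.pairInt (e i) γ : ℤ) : k) := by
    intro i
    rw [map_zsmul, ← P.pair_compat γ hc _ (heR i), zsmul_eq_mul]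
    push_cast; rfl
  simp only [h2] at h1
  rw [vv]
  exact_mod_cast h1

omit hbase he heD in
lemma nf_vv (heR : ∀ i, e i ∈ P.roots) {x : Fin m → ℤ} (h : vv e x ∈ P.roots) (γ : V) :
    P.nf (vv e x) γ = ∑ i, x i * P.nf (e i) γ := by
  unfold nf
  simp only [Finset.mul_sum]
  rw [Finset.sum_comm]
  refine Finset.sum_congr rfl fun α hα => ?_
  rw [P.pair_vv e heR h hα, Finset.sum_mul]
  exact Finset.sum_congr rfl fun i _ => by ring

/-- bound on the norm of positive roots -/
lemma nf_le_pos {M : ℤ} (hM : ∀ i, P.nf (e i) (e i) ≤ M) (n : ℕ) : ∀ x : Fin m → ℤ, 0 ≤ x →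
    vv e x ∈ P.roots → ∑ i, x i ≤ n → P.nf (vv e x) (vv e x) ≤ M := by
  have heR : ∀ i, e i ∈ P.roots := fun i => hbase.subset (heD i)
  induction n with
  | zero =>
    intro x hx hr hs
    exfalso
    have hz : ∀ i, x i = 0 := by
      have h0 : ∑ i, x i = 0 := le_antisymm (by simpa using hs) (Finset.sum_nonneg fun i _ => hx i)
      rw [Finset.sum_eq_zero_iff_of_nonneg (fun i _ => hx i)] at h0
      exact fun i => h0 i (Finset.mem_univ _)
    apply P.ne_zero _ hr
    simp [vv, hz]
  | succ n ih =>
    intro x hx hr hs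
    have h1 := P.nf_self_pos hr
    have h2 := P.nf_vv e heR hr (vv e x)
    rw [h2] at h1
    obtain ⟨i, -, hi⟩ := Finset.exists_lt_of_sum_lt (s := Finset.univ) (f := fun _ => (0:ℤ))
      (g := fun i => x i * P.nf (e i) (vv e x)) (by simpa using h1)
    have hxi : 0 < x i := lt_of_le_of_ne (hx i) (by rintro h; rw [← h] at hi; simp at hi)
    have hni : 0 < P.nf (vv e x) (e i) := by
      rw [P.nf_comm]; exact pos_of_mul_pos_right hi (hx i)
    rw [← P.pair_pos_iff (heR i) hr] at hni
    set p := P.pairInt (vv e x) (e i) with hp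
    have hr' := P.reflect_mem _ (heR i) _ hr
    have hnf := P.nf_refl (heR i) hr hr
    rw [← hp, ← vv_single e i p, ← vv_sub] at hr' hnf
    rw [← hnf]
    rcases P.vv_pos_or_neg hbase e he heD hr' with h | h
    · refine ih _ h hr' ?_
      simp only [Pi.sub_apply, Finset.sum_sub_distrib, Finset.sum_ite_eq', Finset.mem_univ, if_true]
      push_cast at hs
      omega
    · have hz : ∀ j, j ≠ i → x j = 0 := by
        intro j hj
        have := h j
        simp [hj] at this
        exact le_antisymm this (hx j)
      have hx' : x = fun j => if j = i then x i else 0 := by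
        funext j
        split_ifs with hj
        · rw [hj]
        · exact hz j hj
      have hv : vv e x = x i • e i := by
        conv_lhs => rw [hx']
        exact vv_single e i _
      have hone : x i = 1 := by
        have hr2 := hr
        rw [hv, ← Int.cast_smul_eq_zsmul k] at hr2
        rcases P.reduced _ (heR i) _ hr2 with h | h
        · exact_mod_cast h
        · have : x i = -1 := by exact_mod_cast h
          omega
      rw [hnf, hv, hone, one_smul]
      exact hM i

lemma nf_le {M : ℤ} (hM : ∀ i, P.nf (e i) (e i) ≤ M) {x : Fin m → ℤ}
    (hr : vv e x ∈ P.roots) : P.nf (vv e x) (vv e x) ≤ M := by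
  rcases P.vv_pos_or_neg hbase e he heD hr with h | h
  · exact P.nf_le_pos hbase e he heD hM (∑ i, x i).toNat x h hr (by omega)
  · have hr' := P.neg_root hr
    rw [← vv_neg] at hr'
    have h' : 0 ≤ -x := by simpa using h
    have := P.nf_le_pos hbase e he heD hM (∑ i, (-x) i).toNat (-x) h' hr' (by omega)
    have h3 : P.nf (vv e (-x)) (vv e (-x)) = P.nf (vv e x) (vv e x) := by
      have heR : ∀ i, e i ∈ P.roots := fun i => hbase.subset (heD i)
      have hA : ∀ γ, P.nf (vv e (-x)) γ = - P.nf (vv e x) γ := by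
        intro γ
        rw [P.nf_vv e heR hr', P.nf_vv e heR hr]
        simp
      rw [hA, P.nf_comm, hA, neg_neg]
    omega

/-- Criterion for a root to be the highest one. -/
lemma isHighest {S : Finset V} (hS : Finset.image e Finset.univ = S) {c : Fin m → ℤ}
    (hc : ∀ i, 0 < c i) (hr : vv e c ∈ P.roots)
    (hN : ∀ i, P.nf (e i) (e i) ≤ P.nf (vv e c) (vv e c))
    (hdom : ∀ i, 0 ≤ P.pairInt (vv e c) (e i)) : P.IsHighestRoot S (vv e c) := by
  have heR : ∀ i, e i ∈ P.roots := fun i => hbase.subset (heD i)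
  have heS : ∀ i, e i ∈ S := fun i => by rw [← hS]; simp
  have hle : ∀ x, vv e x ∈ P.roots → x ≤ c := by
    intro x0 hx0
    have hfin : {x | vv e x ∈ P.roots}.Finite :=
      P.roots.finite_toSet.preimage (P.vv_inj hbase e he heD).injOn
    obtain ⟨x, hx0x, hx⟩ := hfin.exists_le_maximal hx0
    refine hx0x.trans ?_
    have hxr : vv e x ∈ P.roots := hx.prop
    have hxd : ∀ i, 0 ≤ P.pairInt (vv e x) (e i) := by
      intro i
      by_contra hneg
      push Not at hneg
      have h1 := P.reflect_mem _ (heR i) _ hxr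
      rw [← vv_single e i, ← vv_sub] at h1
      have h2 := hx.le_of_ge h1 (by
        intro j
        simp only [Pi.sub_apply]
        split_ifs <;> omega)
      have := h2 i
      simp at this
      omega
    have hxn : ∀ i, 0 ≤ P.nf (e i) (vv e x) := fun i => by
      rw [P.nf_comm]; exact (P.pair_nonneg_iff (heR i) hxr).1 (hxd i)
    have hpos : 0 < P.nf (vv e x) (vv e c) := by
      rw [P.nf_comm, P.nf_vv e heR hr]
      have h1 := P.nf_self_pos hxr
      by_contra hneg
      have h2 : ∑ i, c i * P.nf (e i) (vv e x) = 0 :=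
        le_antisymm (not_lt.1 hneg) (Finset.sum_nonneg fun i _ => mul_nonneg (hc i).le (hxn i))
      rw [Finset.sum_eq_zero_iff_of_nonneg (fun i _ => mul_nonneg (hc i).le (hxn i))] at h2
      rw [P.nf_vv e heR hxr, Finset.sum_eq_zero] at h1
      · exact lt_irrefl _ h1
      · intro i hi
        rcases mul_eq_zero.1 (h2 i hi) with h | h
        · have := hc i; omega
        · rw [h, mul_zero]
    have hnorm := P.nf_le hbase e he heD hN hxr
    by_cases hxc : vv e x = vv e c
    · rw [P.vv_inj hbase e he heD hxc]
    have hsub := P.sub_mem_of_pos hxr hr hnorm ((P.pair_pos_iff hr hxr).2 hpos) hxc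
    rw [← vv_sub] at hsub
    rcases P.vv_pos_or_neg hbase e he heD hsub with h | h
    · exfalso
      have h1 : 0 ≤ P.nf (vv e (x - c)) (vv e c) := by
        rw [P.nf_vv e heR hsub]
        refine Finset.sum_nonneg fun i _ => mul_nonneg (h i) ?_
        rw [P.nf_comm]; exact (P.pair_nonneg_iff (heR i) hr).1 (hdom i)
      have h2 := P.nf_self_pos hsub
      have hsplit : vv e x = vv e (x - c) - (-1 : ℤ) • vv e c := by
        rw [vv_sub]; module
      have e1 := P.nf_sub_zsmul (γ := vv e x) hr hsub hxr (-1) hsplit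
      have e2 := P.nf_sub_zsmul (γ := vv e (x - c)) hr hsub hxr (-1) hsplit
      have e3 := P.nf_sub_zsmul (γ := vv e c) hr hsub hxr (-1) hsplit
      have c1 := P.nf_comm (vv e x) (vv e (x - c))
      have c2 := P.nf_comm (vv e x) (vv e c)
      have c3 := P.nf_comm (vv e c) (vv e (x - c))
      linarith
    · simpa using h
  refine ⟨?_, ?_⟩
  · simp only [posRootsOf, Finset.mem_filter]
    exact ⟨hr, vv_mem_closure e heS fun i => (hc i).le⟩
  · intro α hα
    simp only [rootsOf, Finset.mem_filter] at hα
    obtain ⟨x, rfl⟩ := exists_vv e hS hα.2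
    rw [← vv_sub]
    exact vv_mem_closure e heS (sub_nonneg.2 (hle x hα.1))

lemma highestRoot_eq {S : Finset V} (hS : Finset.image e Finset.univ = S) {θ : V}
    (h : P.IsHighestRoot S θ) : P.highestRoot S = θ := by
  have hex : ∃ ε, P.IsHighestRoot S ε := ⟨θ, h⟩
  have h1 : P.highestRoot S = hex.choose := by rw [highestRoot, dif_pos hex]
  have h2 := hex.choose_spec
  rw [h1]
  generalize hex.choose = ε at h2
  have hsub : ∀ α ∈ P.posRootsOf S, α ∈ P.rootsOf S := by
    intro α hα
    simp only [posRootsOf, rootsOf, Finset.mem_filter] at hα ⊢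
    refine ⟨hα.1, ?_⟩
    have : AddSubmonoid.closure (S : Set V) ≤ (AddSubgroup.closure (S : Set V)).toAddSubmonoid :=
      AddSubmonoid.closure_le.2 AddSubgroup.subset_closure
    exact this hα.2
  have hSD : AddSubmonoid.closure (S : Set V) ≤ AddSubmonoid.closure (Δ : Set V) := by
    apply AddSubmonoid.closure_mono
    rw [← hS]
    intro x hx
    simp at hx
    obtain ⟨i, rfl⟩ := hx
    exact heD i
  have a1 := hSD (h.2 ε (hsub _ h2.1))
  have a2 := hSD (h2.2 θ (hsub _ h.1))
  obtain ⟨x, hx⟩ := exists_vv e hS (Finset.mem_filter.1 (hsub _ h2.1)).2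
  obtain ⟨y, hy⟩ := exists_vv e hS (Finset.mem_filter.1 (hsub _ h.1)).2
  rw [hx, hy, ← vv_sub] at a1 a2
  have b1 := P.nonneg_of_closure hbase e he heD a1
  have b2 := P.nonneg_of_closure hbase e he heD a2
  rw [hx, hy, le_antisymm (sub_nonneg.1 b1) (sub_nonneg.1 b2)]

end coord

end RootSystemData

namespace RootSystemData

section casc

variable (P : RootSystemData k V)

/-- `S` has a cascade with `r` elements, for every sufficient amount of fuel. -/
def CC (S : Finset V) (r : ℕ) : Prop := ∀ n, S.card ≤ n → (P.cascadeAux n S).card = r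

lemma cc_empty : P.CC ∅ 0 := by
  intro n _
  cases n <;> simp [cascadeAux, components]

lemma mem_cascadeAux (n : ℕ) : ∀ (S C : Finset V), C ∈ P.cascadeAux n S → C ⊆ S ∧ C.Nonempty := by
  induction n with
  | zero => intro S C h; simp [cascadeAux] at h
  | succ n ih =>
    intro S C h
    simp only [cascadeAux, components, Finset.mem_biUnion, Finset.mem_image] at h
    obtain ⟨D, ⟨a, ha, rfl⟩, h⟩ := h
    have hsub : P.component S a ⊆ S := Finset.filter_subset _ _
    rcases Finset.mem_insert.1 h with rfl | h
    · exact ⟨hsub, a, Finset.mem_filter.2 ⟨ha, Relation.ReflTransGen.refl⟩⟩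
    · obtain ⟨h1, h2⟩ := ih _ _ h
      exact ⟨h1.trans ((Finset.filter_subset _ _).trans hsub), h2⟩

lemma cc_connected {S : Finset V} (hS : P.IsConnected S) {r : ℕ}
    (hz : P.zeroPart S ≠ S) (h : P.CC (P.zeroPart S) r) : P.CC S (r + 1) := by
  intro n hn
  have hpos : 0 < S.card := hS.1.card_pos
  obtain ⟨n, rfl⟩ : ∃ n', n = n' + 1 := ⟨n - 1, by omega⟩
  have hcomp : P.components S = {S} := by
    have h1 : ∀ a ∈ S, P.component S a = S := fun a ha =>
      Finset.filter_true_of_mem fun b hb => hS.2 a ha b hb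
    ext C
    simp only [components, Finset.mem_image, Finset.mem_singleton]
    constructor
    · rintro ⟨a, ha, rfl⟩; exact h1 a ha
    · rintro rfl
      obtain ⟨a, ha⟩ := hS.1
      exact ⟨a, ha, h1 a ha⟩
  have hss : P.zeroPart S ⊂ S := lt_of_le_of_ne (Finset.filter_subset _ _) hz
  have hc := Finset.card_lt_card hss
  simp only [cascadeAux, hcomp, Finset.singleton_biUnion]
  rw [Finset.card_insert_of_notMem, h n (by omega)]
  intro hmem
  exact hz (le_antisymm (Finset.filter_subset _ _) (P.mem_cascadeAux n _ _ hmem).1)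

lemma linked_symm {S : Finset V}
    (h : ∀ x y, (x ∈ S ∧ y ∈ S ∧ P.pairInt x y ≠ 0) → (y ∈ S ∧ x ∈ S ∧ P.pairInt y x ≠ 0))
    {a b : V} (hl : P.Linked S a b) : P.Linked S b a := by
  induction hl with
  | refl => exact Relation.ReflTransGen.refl
  | tail _ hbc ih => exact Relation.ReflTransGen.head (h _ _ hbc) ih

lemma linked_union {S T : Finset V} (h : ∀ a ∈ S, ∀ b ∈ T, P.pairInt a b = 0)
    {a b : V} (ha : a ∈ S) (hl : P.Linked (S ∪ T) a b) : b ∈ S ∧ P.Linked S a b := by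
  induction hl with
  | refl => exact ⟨ha, Relation.ReflTransGen.refl⟩
  | tail _ hbc ih =>
    obtain ⟨hb, hc, hp⟩ := hbc
    have hcS := (Finset.mem_union.1 hc).resolve_right fun hcT => hp (h _ ih.1 _ hcT)
    exact ⟨hcS, ih.2.tail ⟨ih.1, hcS, hp⟩⟩

lemma component_union {S T : Finset V} (h : ∀ a ∈ S, ∀ b ∈ T, P.pairInt a b = 0)
    {a : V} (ha : a ∈ S) : P.component (S ∪ T) a = P.component S a := by
  ext b
  simp only [component, Finset.mem_filter]
  constructor
  · rintro ⟨_, hl⟩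
    exact P.linked_union h ha hl
  · rintro ⟨hb, hl⟩
    refine ⟨Finset.mem_union_left _ hb, Relation.ReflTransGen.mono ?_ _ _ hl⟩
    rintro x y ⟨hx, hy, hp⟩
    exact ⟨Finset.mem_union_left _ hx, Finset.mem_union_left _ hy, hp⟩

lemma cc_union {S T : Finset V} (hd : Disjoint S T) (h : ∀ a ∈ S, ∀ b ∈ T, P.pairInt a b = 0)
    (h' : ∀ a ∈ T, ∀ b ∈ S, P.pairInt a b = 0) {r s : ℕ} (hS : P.CC S r) (hT : P.CC T s) :
    P.CC (S ∪ T) (r + s) := by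
  have hcomp : P.components (S ∪ T) = P.components S ∪ P.components T := by
    unfold components
    rw [Finset.image_union]
    congr 1
    · exact Finset.image_congr fun a ha => P.component_union h ha
    · refine Finset.image_congr fun a ha => ?_
      rw [Finset.union_comm]
      exact P.component_union h' ha
  intro n hn
  have hc := Finset.card_union_of_disjoint hd
  rw [← hS n (by omega), ← hT n (by omega), ← Finset.card_union_of_disjoint]
  · congr 1
    cases n with
    | zero => simp [cascadeAux]
    | succ n => simp only [cascadeAux, hcomp, Finset.union_biUnion]
  · rw [Finset.disjoint_left]
    intro C h1 h2
    obtain ⟨s1, ⟨x, hx⟩⟩ := P.mem_cascadeAux _ _ _ h1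
    obtain ⟨s2, -⟩ := P.mem_cascadeAux _ _ _ h2
    exact Finset.disjoint_left.1 hd (s1 hx) (s2 hx)

end casc

/-- Coefficient vectors obtained from the simple root `i0` by simple reflections. -/
inductive Reach {m : ℕ} (A : Fin m → Fin m → ℤ) (i0 : Fin m) : (Fin m → ℤ) → Prop
  | base (c : Fin m → ℤ) (h : ∀ j, c j = if j = i0 then 1 else 0) : Reach A i0 c
  | step (c c' : Fin m → ℤ) (i : Fin m) (h : Reach A i0 c)
      (h' : ∀ j, c' j = c j - if j = i then ∑ l, c l * A l i else 0) : Reach A i0 c'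

section main

variable {m : ℕ} (P : RootSystemData k V) {Δ : Finset V} (hbase : P.IsBase Δ)
  {A : Fin m → Fin m → ℤ} {e : Fin m → V} (he : Function.Injective e) (heD : ∀ i, e i ∈ Δ)
  (hA : ∀ i j, P.pairInt (e i) (e j) = A i j)

include hbase he heD hA

omit he in
lemma reach_inv {S : Finset V} (hS : Finset.image e Finset.univ = S)
    {D : Fin m → ℤ} (hD : ∀ i, 0 < D i) (hsym : ∀ i j, A i j * D j = A j i * D i)
    {i0 : Fin m} {c : Fin m → ℤ} (h : Reach A i0 c) :
    vv e c ∈ P.roots ∧ P.nf (vv e c) (vv e c) = P.nf (e i0) (e i0) ∧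
    ∀ j, c j ≠ 0 → P.Linked S (e i0) (e j) ∧
      P.nf (e i0) (e i0) * D j = P.nf (e j) (e j) * D i0 := by
  have heR : ∀ i, e i ∈ P.roots := fun i => hbase.subset (heD i)
  have heS : ∀ i, e i ∈ S := fun i => by rw [← hS]; simp
  induction h with
  | base c h =>
    have hv : vv e c = e i0 := by
      rw [show c = fun j => if j = i0 then 1 else 0 from funext h, vv_single, one_smul]
    refine ⟨by rw [hv]; exact heR _, by rw [hv], ?_⟩
    intro j hj
    rw [h] at hj
    have : j = i0 := by by_contra hne; simp [hne] at hj
    subst this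
    exact ⟨Relation.ReflTransGen.refl, rfl⟩
  | step c c' i _ h' ih =>
    obtain ⟨ih1, ih2, ih3⟩ := ih
    have hp : P.pairInt (vv e c) (e i) = ∑ l, c l * A l i := by
      rw [P.pair_vv e heR ih1 (heR i)]
      simp only [hA]
    have hv : vv e c' = vv e c - P.pairInt (vv e c) (e i) • e i := by
      rw [← vv_single, ← vv_sub, hp]
      congr 1
      funext j
      exact h' j
    refine ⟨by rw [hv]; exact P.reflect_mem _ (heR i) _ ih1, by
      rw [hv, P.nf_refl (heR i) ih1 ih1, ih2], ?_⟩
    intro j hj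
    by_cases hcj : c j = 0
    · have hji : j = i := by
        by_contra hne
        rw [h', hcj] at hj
        simp [hne] at hj
      subst hji
      have hne : ∑ l, c l * A l j ≠ 0 := by
        intro h0
        rw [h', hcj, h0] at hj
        simp at hj
      obtain ⟨l, -, hl⟩ := Finset.exists_ne_zero_of_sum_ne_zero hne
      obtain ⟨b1, b2⟩ := ih3 l (left_ne_zero_of_mul hl)
      have hAl := right_ne_zero_of_mul hl
      refine ⟨b1.tail ⟨heS l, heS j, by rw [hA]; exact hAl⟩, ?_⟩
      have q1 := P.pair_mul_nf (heR j) (heR l)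
      have q2 := P.pair_mul_nf (heR l) (heR j)
      rw [P.nf_comm (e l) (e j), ← q2, hA, hA] at q1
      have q3 := hsym l j
      have q4 : A l j * (P.nf (e i0) (e i0) * D j) * D l = A l j * (P.nf (e j) (e j) * D i0) * D l := by
        calc A l j * (P.nf (e i0) (e i0) * D j) * D l
            = (P.nf (e i0) (e i0) * D l) * (A l j * D j) := by ring
          _ = (P.nf (e l) (e l) * D i0) * (A j l * D l) := by rw [b2, q3]
          _ = (A j l * P.nf (e l) (e l)) * D i0 * D l := by ring
          _ = _ := by rw [← q1]; ring
      exact mul_left_cancel₀ hAl (mul_right_cancel₀ (hD l).ne' q4)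
    · exact ih3 j hcj

/-- Main recursion step for cascades of a connected subset of the base. -/
theorem cc_step {S : Finset V} (hS : Finset.image e Finset.univ = S)
    (D : Fin m → ℤ) (hD : ∀ i, 0 < D i) (hsym : ∀ i j, A i j * D j = A j i * D i)
    (i0 : Fin m) (hmax : ∀ i, D i ≤ D i0) (c : Fin m → ℤ) (h : Reach A i0 c)
    (hc : ∀ i, 0 < c i) (q : Fin m → ℤ) (hq : ∀ i, ∑ l, c l * A l i = q i)
    (hq0 : ∀ i, 0 ≤ q i) (i1 : Fin m) (hq1 : q i1 ≠ 0) {r : ℕ}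
    (hr : P.CC (Finset.image e (Finset.univ.filter fun i => q i = 0)) r) :
    P.CC S (r + 1) := by
  have heR : ∀ i, e i ∈ P.roots := fun i => hbase.subset (heD i)
  have heS : ∀ i, e i ∈ S := fun i => by rw [← hS]; simp
  obtain ⟨h1, h2, h3⟩ := P.reach_inv hbase heD hA hS hD hsym h
  have hp : ∀ i, P.pairInt (vv e c) (e i) = q i := by
    intro i
    rw [P.pair_vv e heR h1 (heR i), ← hq]
    simp only [hA]
  have hhigh : P.IsHighestRoot S (vv e c) := by
    refine P.isHighest hbase e he heD hS hc h1 ?_ fun i => by rw [hp]; exact hq0 i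
    intro i
    rw [h2]
    have e1 := (h3 i (hc i).ne').2
    have e2 := hmax i
    have e3 := P.nf_self_pos (heR i)
    have e4 := P.nf_self_pos (heR i0)
    have e5 := hD i0
    have e6 : P.nf (e i) (e i) * D i0 ≤ P.nf (e i0) (e i0) * D i0 := by
      rw [← e1]; exact mul_le_mul_of_nonneg_left e2 e4.le
    exact le_of_mul_le_mul_right e6 e5
  have hhr := P.highestRoot_eq hbase e he heD hS hhigh
  have hzero : P.zeroPart S = Finset.image e (Finset.univ.filter fun i => q i = 0) := by
    ext x
    simp only [zeroPart, hhr, Finset.mem_filter, Finset.mem_image, Finset.mem_univ, true_and]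
    rw [← hS]
    simp only [Finset.mem_image, Finset.mem_univ, true_and]
    constructor
    · rintro ⟨⟨i, rfl⟩, hx⟩
      refine ⟨i, ?_, rfl⟩
      rw [← hp]
      exact (P.pair_zero_symm h1 (heR i)).1 hx
    · rintro ⟨i, hi, rfl⟩
      exact ⟨⟨i, rfl⟩, (P.pair_zero_symm h1 (heR i)).2 (by rw [hp]; exact hi)⟩
  have hconn : P.IsConnected S := by
    refine ⟨⟨e i0, heS i0⟩, ?_⟩
    intro a ha b hb
    rw [← hS] at ha hb
    simp only [Finset.mem_image, Finset.mem_univ, true_and] at ha hb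
    obtain ⟨i, rfl⟩ := ha
    obtain ⟨j, rfl⟩ := hb
    have l1 := (h3 i (hc i).ne').1
    have l2 := (h3 j (hc j).ne').1
    refine Relation.ReflTransGen.trans (P.linked_symm ?_ l1) l2
    rintro x y ⟨hx, hy, hxy⟩
    rw [← hS] at hx hy
    refine ⟨by rw [← hS]; exact hy, by rw [← hS]; exact hx, ?_⟩
    simp only [Finset.mem_image, Finset.mem_univ, true_and] at hx hy
    obtain ⟨i, rfl⟩ := hx
    obtain ⟨j, rfl⟩ := hy
    exact fun h0 => hxy ((P.pair_zero_symm (heR i) (heR j)).1 h0)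
  refine P.cc_connected hconn ?_ (by rw [hzero]; exact hr)
  rw [hzero]
  intro heq
  have := heS i1
  rw [← heq] at this
  simp only [Finset.mem_image, Finset.mem_filter, Finset.mem_univ, true_and] at this
  obtain ⟨i, hi, hii⟩ := this
  rw [he hii] at hi
  exact hq1 hi

end main

end RootSystemData

namespace RootSystemData

section families

lemma sum_four {m : ℕ} (C : ℕ → ℤ) (i : ℕ) (hi : i < m) (a b d : ℤ) (t : ℕ) (ht : t < m)
    (F : Fin m → ℤ) (hF : ∀ l : Fin m, F l = C l * ((if (l : ℕ) = i then 2 else 0) +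
      (if (l : ℕ) + 1 = i then a else 0) + (if (l : ℕ) = i + 1 then b else 0) +
      (if (l : ℕ) = t then d else 0))) :
    ∑ l, F l = 2 * C i + (if 1 ≤ i then a * C (i - 1) else 0) +
      (if i + 1 < m then b * C (i + 1) else 0) + d * C t := by
  simp only [hF]
  rw [Fin.sum_univ_eq_sum_range (fun l => C l * ((if l = i then 2 else 0) +
      (if l + 1 = i then a else 0) + (if l = i + 1 then b else 0) +
      (if l = t then d else 0))) m]
  simp only [mul_add, Finset.sum_add_distrib, mul_ite, mul_zero]
  rw [Finset.sum_ite_eq', Finset.sum_ite_eq', Finset.sum_ite_eq']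
  have h2 : ∑ x ∈ Finset.range m, (if x + 1 = i then C x * a else 0) =
      if 1 ≤ i then a * C (i - 1) else 0 := by
    split_ifs with h
    · have : ∀ x, (x + 1 = i) ↔ (x = i - 1) := fun x => by omega
      simp only [this]
      rw [Finset.sum_ite_eq', if_pos (by simp; omega), mul_comm]
    · refine Finset.sum_eq_zero fun x _ => if_neg (by omega)
  rw [h2]
  simp only [Finset.mem_range, hi, ht, if_true]
  split_ifs <;> ring

lemma sum_A {m : ℕ} (C : ℕ → ℤ) (i : Fin m) : ∑ l : Fin m, C l * cartanA m l i =
    2 * C i + (if 1 ≤ (i : ℕ) then -1 * C (i - 1) else 0) +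
      (if (i : ℕ) + 1 < m then -1 * C (i + 1) else 0) := by
  rw [sum_four C i i.2 (-1) (-1) 0 i i.2, zero_mul, add_zero]
  intro l
  congr 1
  unfold cartanA
  split_ifs <;> omega

lemma sum_B {m : ℕ} (C : ℕ → ℤ) (i : Fin m) : ∑ l : Fin m, C l * cartanB m l i =
    2 * C i + (if 1 ≤ (i : ℕ) then (if (i : ℕ) = m - 1 then -2 else -1) * C (i - 1) else 0) +
      (if (i : ℕ) + 1 < m then -1 * C (i + 1) else 0) := by
  rw [sum_four C i i.2 (if (i : ℕ) = m - 1 then -2 else -1) (-1) 0 i i.2, zero_mul, add_zero]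
  intro l
  congr 1
  unfold cartanB
  split_ifs <;> omega

lemma sum_C {m : ℕ} (C : ℕ → ℤ) (i : Fin m) : ∑ l : Fin m, C l * cartanC m l i =
    2 * C i + (if 1 ≤ (i : ℕ) then -1 * C (i - 1) else 0) +
      (if (i : ℕ) + 1 < m then (if (i : ℕ) + 1 = m - 1 then -2 else -1) * C (i + 1) else 0) := by
  rw [sum_four C i i.2 (-1) (if (i : ℕ) + 1 = m - 1 then -2 else -1) 0 i i.2, zero_mul, add_zero]
  intro l
  congr 1
  unfold cartanC cartanB
  split_ifs <;> omega

lemma sum_D {m : ℕ} (hm : 3 ≤ m) (C : ℕ → ℤ) (i : Fin m) : ∑ l : Fin m, C l * cartanD m l i =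
    2 * C i + (if 1 ≤ (i : ℕ) then (if (i : ℕ) ≤ m - 2 then -1 else 0) * C (i - 1) else 0) +
      (if (i : ℕ) + 1 < m then (if (i : ℕ) + 1 ≤ m - 2 then -1 else 0) * C (i + 1) else 0) +
      (if (i : ℕ) = m - 1 then -1 else if (i : ℕ) = m - 3 then -1 else 0) *
        C (if (i : ℕ) = m - 1 then m - 3 else m - 1) := by
  rw [sum_four C i i.2 (if (i : ℕ) ≤ m - 2 then -1 else 0)
    (if (i : ℕ) + 1 ≤ m - 2 then -1 else 0)
    (if (i : ℕ) = m - 1 then -1 else if (i : ℕ) = m - 3 then -1 else 0)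
    (if (i : ℕ) = m - 1 then m - 3 else m - 1) (by split_ifs <;> omega)]
  intro l
  congr 1
  unfold cartanD
  have := l.2
  have := i.2
  split_ifs <;> omega

lemma Reach.step2 {m : ℕ} {A : Fin m → Fin m → ℤ} {i0 : Fin m} {c c' : Fin m → ℤ} (i : Fin m)
    (p : ℤ) (h : Reach A i0 c) (hp : ∑ l, c l * A l i = p)
    (h' : ∀ j, c' j = c j - if j = i then p else 0) : Reach A i0 c' :=
  Reach.step c c' i h fun j => by rw [hp]; exact h' j

lemma reach_A {m : ℕ} (hm : 0 < m) (n : ℕ) (hn : n < m) :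
    Reach (cartanA m) ⟨0, hm⟩ (fun j => (fun j : ℕ => if j ≤ n then (1 : ℤ) else 0) j) := by
  induction n with
  | zero =>
    refine Reach.base _ fun j => ?_
    simp only [Fin.ext_iff]
    split_ifs <;> omega
  | succ n ih =>
    refine Reach.step2 ⟨n + 1, hn⟩ (-1) (ih (by omega)) ?_ fun j => ?_
    · rw [sum_A (fun j : ℕ => if j ≤ n then (1 : ℤ) else 0)]
      simp (disch := omega) only [if_pos, if_neg]
      split_ifs <;> omega
    · simp only [Fin.ext_iff]
      split_ifs <;> omega

lemma reach_C {m : ℕ} (hm : 0 < m) (n : ℕ) (hn : n < m) :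
    Reach (cartanC m) ⟨m - 1, by omega⟩ (fun j => (fun j : ℕ =>
      if j < m - 1 - n then (0 : ℤ) else if j < m - 1 then 2 else 1) j) := by
  induction n with
  | zero =>
    refine Reach.base _ fun j => ?_
    have := j.2
    simp only [Fin.ext_iff]
    split_ifs <;> omega
  | succ n ih =>
    refine Reach.step2 ⟨m - 1 - (n + 1), by omega⟩ (-2) (ih (by omega)) ?_ fun j => ?_
    · rw [sum_C (fun j : ℕ => if j < m - 1 - n then (0 : ℤ) else if j < m - 1 then 2 else 1)]
      simp (disch := omega) only [if_pos, if_neg]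
      split_ifs <;> omega
    · have := j.2
      simp only [Fin.ext_iff]
      split_ifs <;> omega

lemma reach_B {m : ℕ} (hm : 2 ≤ m) (n : ℕ) (hn : n + 2 ≤ m) :
    Reach (cartanB m) ⟨m - 2, by omega⟩ (fun j => (fun j : ℕ =>
      if j < m - 2 - n then (0 : ℤ) else if j = m - 2 - n then 1 else 2) j) := by
  induction n with
  | zero =>
    refine Reach.step2 (c := fun j => (fun j : ℕ => if j = m - 2 then (1 : ℤ) else 0) j)
      ⟨m - 1, by omega⟩ (-2) (Reach.base _ fun j => ?_) ?_ fun j => ?_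
    · simp only [Fin.ext_iff]
    · rw [sum_B (fun j : ℕ => if j = m - 2 then (1 : ℤ) else 0)]
      simp (disch := omega) only [if_pos, if_neg]
      try simp (disch := omega) only [if_pos, if_neg, if_true, if_false]
      first | omega | (split_ifs <;> omega)
    · have := j.2
      simp only [Fin.ext_iff]
      split_ifs <;> omega
  | succ n ih =>
    refine Reach.step2 (c := fun j => (fun j : ℕ => if j < m - 2 - (n + 1) then (0 : ℤ) else
      if j = m - 2 - (n + 1) then 1 else if j = m - 2 - n then 1 else 2) j)
      ⟨m - 2 - n, by omega⟩ (-1)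
      (Reach.step2 ⟨m - 2 - (n + 1), by omega⟩ (-1) (ih (by omega)) ?_ fun j => ?_) ?_ fun j => ?_
    · rw [sum_B (fun j : ℕ => if j < m - 2 - n then (0 : ℤ) else if j = m - 2 - n then 1 else 2)]
      simp (disch := omega) only [if_pos, if_neg]
      split_ifs <;> omega
    · have := j.2
      simp only [Fin.ext_iff]
      split_ifs <;> omega
    · rw [sum_B (fun j : ℕ => if j < m - 2 - (n + 1) then (0 : ℤ) else
        if j = m - 2 - (n + 1) then 1 else if j = m - 2 - n then 1 else 2)]
      simp (disch := omega) only [if_pos, if_neg]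
      try simp (disch := omega) only [if_pos, if_neg, if_true, if_false]
      first | omega | (split_ifs <;> omega)
    · have := j.2
      simp only [Fin.ext_iff]
      split_ifs <;> omega

lemma reach_D {m : ℕ} (hm : 3 ≤ m) (n : ℕ) (hn : n + 3 ≤ m) :
    Reach (cartanD m) ⟨m - 3, by omega⟩ (fun j => (fun j : ℕ =>
      if j < m - 3 - n then (0 : ℤ) else if j = m - 3 - n then 1 else
        if j ≤ m - 3 then 2 else 1) j) := by
  induction n with
  | zero =>
    refine Reach.step2 (c := fun j => (fun j : ℕ => if j < m - 3 then (0 : ℤ) else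
      if j = m - 1 then 0 else 1) j) ⟨m - 1, by omega⟩ (-1)
      (Reach.step2 (c := fun j => (fun j : ℕ => if j = m - 3 then (1 : ℤ) else 0) j)
      ⟨m - 2, by omega⟩ (-1) (Reach.base _ fun j => ?_) ?_ fun j => ?_) ?_ fun j => ?_
    · simp only [Fin.ext_iff]
    · rw [sum_D hm (fun j : ℕ => if j = m - 3 then (1 : ℤ) else 0)]
      simp (disch := omega) only [if_pos, if_neg]
      try simp (disch := omega) only [if_pos, if_neg, if_true, if_false]
      first | omega | (split_ifs <;> omega)
    · have := j.2
      simp only [Fin.ext_iff]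
      split_ifs <;> omega
    · rw [sum_D hm (fun j : ℕ => if j < m - 3 then (0 : ℤ) else if j = m - 1 then 0 else 1)]
      simp (disch := omega) only [if_pos, if_neg]
      try simp (disch := omega) only [if_pos, if_neg, if_true, if_false]
      first | omega | (split_ifs <;> omega)
    · have := j.2
      simp only [Fin.ext_iff]
      split_ifs <;> omega
  | succ n ih =>
    refine Reach.step2 (c := fun j => (fun j : ℕ => if j < m - 3 - (n + 1) then (0 : ℤ) else
      if j ≤ m - 3 - n then 1 else if j ≤ m - 3 then 2 else 1) j)
      ⟨m - 3 - n, by omega⟩ (-1)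
      (Reach.step2 ⟨m - 3 - (n + 1), by omega⟩ (-1) (ih (by omega)) ?_ fun j => ?_) ?_ fun j => ?_
    · rw [sum_D hm (fun j : ℕ => if j < m - 3 - n then (0 : ℤ) else if j = m - 3 - n then 1 else
        if j ≤ m - 3 then 2 else 1)]
      simp (disch := omega) only [if_pos, if_neg]
      split_ifs <;> omega
    · have := j.2
      simp only [Fin.ext_iff]
      split_ifs <;> omega
    · rw [sum_D hm (fun j : ℕ => if j < m - 3 - (n + 1) then (0 : ℤ) else
        if j ≤ m - 3 - n then 1 else if j ≤ m - 3 then 2 else 1)]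
      by_cases h3 : n = 0
      · subst h3
        simp (disch := omega) only [if_pos, if_neg]
        try simp (disch := omega) only [if_pos, if_neg, if_true, if_false]
        first | omega | (split_ifs <;> omega)
      · simp (disch := omega) only [if_pos, if_neg]
        try simp (disch := omega) only [if_pos, if_neg, if_true, if_false]
        first | omega | (split_ifs <;> omega)
    · have := j.2
      simp only [Fin.ext_iff]
      split_ifs <;> omega

end families

end RootSystemData

namespace RootSystemData

lemma reach_E6 : Reach (cartanE 6) 0 ![1, 2, 2, 3, 2, 1] := by
  have h : Reach (cartanE 6) 0 ![1, 0, 0, 0, 0, 0] := Reach.base _ (by decide)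
  replace h := Reach.step2 (c' := ![1, 0, 1, 0, 0, 0]) 2 (-1) h (by decide +kernel) (by decide +kernel)
  replace h := Reach.step2 (c' := ![1, 0, 1, 1, 0, 0]) 3 (-1) h (by decide +kernel) (by decide +kernel)
  replace h := Reach.step2 (c' := ![1, 1, 1, 1, 0, 0]) 1 (-1) h (by decide +kernel) (by decide +kernel)
  replace h := Reach.step2 (c' := ![1, 1, 1, 1, 1, 0]) 4 (-1) h (by decide +kernel) (by decide +kernel)
  replace h := Reach.step2 (c' := ![1, 1, 1, 2, 1, 0]) 3 (-1) h (by decide +kernel) (by decide +kernel)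
  replace h := Reach.step2 (c' := ![1, 1, 2, 2, 1, 0]) 2 (-1) h (by decide +kernel) (by decide +kernel)
  replace h := Reach.step2 (c' := ![1, 1, 2, 2, 1, 1]) 5 (-1) h (by decide +kernel) (by decide +kernel)
  replace h := Reach.step2 (c' := ![1, 1, 2, 2, 2, 1]) 4 (-1) h (by decide +kernel) (by decide +kernel)
  replace h := Reach.step2 (c' := ![1, 1, 2, 3, 2, 1]) 3 (-1) h (by decide +kernel) (by decide +kernel)
  replace h := Reach.step2 (c' := ![1, 2, 2, 3, 2, 1]) 1 (-1) h (by decide +kernel) (by decide +kernel)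
  exact h

lemma reach_E7 : Reach (cartanE 7) 0 ![2, 2, 3, 4, 3, 2, 1] := by
  have h : Reach (cartanE 7) 0 ![1, 0, 0, 0, 0, 0, 0] := Reach.base _ (by decide)
  replace h := Reach.step2 (c' := ![1, 0, 1, 0, 0, 0, 0]) 2 (-1) h (by decide +kernel) (by decide +kernel)
  replace h := Reach.step2 (c' := ![1, 0, 1, 1, 0, 0, 0]) 3 (-1) h (by decide +kernel) (by decide +kernel)
  replace h := Reach.step2 (c' := ![1, 1, 1, 1, 0, 0, 0]) 1 (-1) h (by decide +kernel) (by decide +kernel)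
  replace h := Reach.step2 (c' := ![1, 1, 1, 1, 1, 0, 0]) 4 (-1) h (by decide +kernel) (by decide +kernel)
  replace h := Reach.step2 (c' := ![1, 1, 1, 2, 1, 0, 0]) 3 (-1) h (by decide +kernel) (by decide +kernel)
  replace h := Reach.step2 (c' := ![1, 1, 2, 2, 1, 0, 0]) 2 (-1) h (by decide +kernel) (by decide +kernel)
  replace h := Reach.step2 (c' := ![1, 1, 2, 2, 1, 1, 0]) 5 (-1) h (by decide +kernel) (by decide +kernel)
  replace h := Reach.step2 (c' := ![1, 1, 2, 2, 2, 1, 0]) 4 (-1) h (by decide +kernel) (by decide +kernel)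
  replace h := Reach.step2 (c' := ![1, 1, 2, 3, 2, 1, 0]) 3 (-1) h (by decide +kernel) (by decide +kernel)
  replace h := Reach.step2 (c' := ![1, 2, 2, 3, 2, 1, 0]) 1 (-1) h (by decide +kernel) (by decide +kernel)
  replace h := Reach.step2 (c' := ![1, 2, 2, 3, 2, 1, 1]) 6 (-1) h (by decide +kernel) (by decide +kernel)
  replace h := Reach.step2 (c' := ![1, 2, 2, 3, 2, 2, 1]) 5 (-1) h (by decide +kernel) (by decide +kernel)
  replace h := Reach.step2 (c' := ![1, 2, 2, 3, 3, 2, 1]) 4 (-1) h (by decide +kernel) (by decide +kernel)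
  replace h := Reach.step2 (c' := ![1, 2, 2, 4, 3, 2, 1]) 3 (-1) h (by decide +kernel) (by decide +kernel)
  replace h := Reach.step2 (c' := ![1, 2, 3, 4, 3, 2, 1]) 2 (-1) h (by decide +kernel) (by decide +kernel)
  replace h := Reach.step2 (c' := ![2, 2, 3, 4, 3, 2, 1]) 0 (-1) h (by decide +kernel) (by decide +kernel)
  exact h

lemma reach_E8 : Reach (cartanE 8) 0 ![2, 3, 4, 6, 5, 4, 3, 2] := by
  have h : Reach (cartanE 8) 0 ![1, 0, 0, 0, 0, 0, 0, 0] := Reach.base _ (by decide)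
  replace h := Reach.step2 (c' := ![1, 0, 1, 0, 0, 0, 0, 0]) 2 (-1) h (by decide +kernel) (by decide +kernel)
  replace h := Reach.step2 (c' := ![1, 0, 1, 1, 0, 0, 0, 0]) 3 (-1) h (by decide +kernel) (by decide +kernel)
  replace h := Reach.step2 (c' := ![1, 1, 1, 1, 0, 0, 0, 0]) 1 (-1) h (by decide +kernel) (by decide +kernel)
  replace h := Reach.step2 (c' := ![1, 1, 1, 1, 1, 0, 0, 0]) 4 (-1) h (by decide +kernel) (by decide +kernel)
  replace h := Reach.step2 (c' := ![1, 1, 1, 2, 1, 0, 0, 0]) 3 (-1) h (by decide +kernel) (by decide +kernel)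
  replace h := Reach.step2 (c' := ![1, 1, 2, 2, 1, 0, 0, 0]) 2 (-1) h (by decide +kernel) (by decide +kernel)
  replace h := Reach.step2 (c' := ![1, 1, 2, 2, 1, 1, 0, 0]) 5 (-1) h (by decide +kernel) (by decide +kernel)
  replace h := Reach.step2 (c' := ![1, 1, 2, 2, 2, 1, 0, 0]) 4 (-1) h (by decide +kernel) (by decide +kernel)
  replace h := Reach.step2 (c' := ![1, 1, 2, 3, 2, 1, 0, 0]) 3 (-1) h (by decide +kernel) (by decide +kernel)
  replace h := Reach.step2 (c' := ![1, 2, 2, 3, 2, 1, 0, 0]) 1 (-1) h (by decide +kernel) (by decide +kernel)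
  replace h := Reach.step2 (c' := ![1, 2, 2, 3, 2, 1, 1, 0]) 6 (-1) h (by decide +kernel) (by decide +kernel)
  replace h := Reach.step2 (c' := ![1, 2, 2, 3, 2, 2, 1, 0]) 5 (-1) h (by decide +kernel) (by decide +kernel)
  replace h := Reach.step2 (c' := ![1, 2, 2, 3, 3, 2, 1, 0]) 4 (-1) h (by decide +kernel) (by decide +kernel)
  replace h := Reach.step2 (c' := ![1, 2, 2, 4, 3, 2, 1, 0]) 3 (-1) h (by decide +kernel) (by decide +kernel)
  replace h := Reach.step2 (c' := ![1, 2, 3, 4, 3, 2, 1, 0]) 2 (-1) h (by decide +kernel) (by decide +kernel)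
  replace h := Reach.step2 (c' := ![2, 2, 3, 4, 3, 2, 1, 0]) 0 (-1) h (by decide +kernel) (by decide +kernel)
  replace h := Reach.step2 (c' := ![2, 2, 3, 4, 3, 2, 1, 1]) 7 (-1) h (by decide +kernel) (by decide +kernel)
  replace h := Reach.step2 (c' := ![2, 2, 3, 4, 3, 2, 2, 1]) 6 (-1) h (by decide +kernel) (by decide +kernel)
  replace h := Reach.step2 (c' := ![2, 2, 3, 4, 3, 3, 2, 1]) 5 (-1) h (by decide +kernel) (by decide +kernel)
  replace h := Reach.step2 (c' := ![2, 2, 3, 4, 4, 3, 2, 1]) 4 (-1) h (by decide +kernel) (by decide +kernel)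
  replace h := Reach.step2 (c' := ![2, 2, 3, 5, 4, 3, 2, 1]) 3 (-1) h (by decide +kernel) (by decide +kernel)
  replace h := Reach.step2 (c' := ![2, 3, 3, 5, 4, 3, 2, 1]) 1 (-1) h (by decide +kernel) (by decide +kernel)
  replace h := Reach.step2 (c' := ![2, 3, 4, 5, 4, 3, 2, 1]) 2 (-1) h (by decide +kernel) (by decide +kernel)
  replace h := Reach.step2 (c' := ![2, 3, 4, 6, 4, 3, 2, 1]) 3 (-1) h (by decide +kernel) (by decide +kernel)
  replace h := Reach.step2 (c' := ![2, 3, 4, 6, 5, 3, 2, 1]) 4 (-1) h (by decide +kernel) (by decide +kernel)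
  replace h := Reach.step2 (c' := ![2, 3, 4, 6, 5, 4, 2, 1]) 5 (-1) h (by decide +kernel) (by decide +kernel)
  replace h := Reach.step2 (c' := ![2, 3, 4, 6, 5, 4, 3, 1]) 6 (-1) h (by decide +kernel) (by decide +kernel)
  replace h := Reach.step2 (c' := ![2, 3, 4, 6, 5, 4, 3, 2]) 7 (-1) h (by decide +kernel) (by decide +kernel)
  exact h

lemma reach_F4 : Reach (cartanF) 0 ![2, 3, 4, 2] := by
  have h : Reach (cartanF) 0 ![1, 0, 0, 0] := Reach.base _ (by decide)
  replace h := Reach.step2 (c' := ![1, 1, 0, 0]) 1 (-1) h (by decide +kernel) (by decide +kernel)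
  replace h := Reach.step2 (c' := ![1, 1, 2, 0]) 2 (-2) h (by decide +kernel) (by decide +kernel)
  replace h := Reach.step2 (c' := ![1, 2, 2, 0]) 1 (-1) h (by decide +kernel) (by decide +kernel)
  replace h := Reach.step2 (c' := ![1, 2, 2, 2]) 3 (-2) h (by decide +kernel) (by decide +kernel)
  replace h := Reach.step2 (c' := ![1, 2, 4, 2]) 2 (-2) h (by decide +kernel) (by decide +kernel)
  replace h := Reach.step2 (c' := ![1, 3, 4, 2]) 1 (-1) h (by decide +kernel) (by decide +kernel)
  replace h := Reach.step2 (c' := ![2, 3, 4, 2]) 0 (-1) h (by decide +kernel) (by decide +kernel)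
  exact h

lemma reach_G2 : Reach (cartanG) 1 ![3, 2] := by
  have h : Reach (cartanG) 1 ![0, 1] := Reach.base _ (by decide)
  replace h := Reach.step2 (c' := ![3, 1]) 0 (-3) h (by decide +kernel) (by decide +kernel)
  replace h := Reach.step2 (c' := ![3, 2]) 1 (-1) h (by decide +kernel) (by decide +kernel)
  exact h


end RootSystemData

namespace RootSystemData

lemma qB {l i : ℕ} (h2 : 2 ≤ l) (hi : i < l) : (2 * (if i = 0 then (1:ℤ) else 2)) + (if 1 ≤ i then (if i = l - 1 then -2 else -1) * (if i - 1 = 0 then (1:ℤ) else 2) else 0) +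
      (if i + 1 < l then -1 * (if i + 1 = 0 then (1:ℤ) else 2) else 0) = if i = 1 then (if l = 2 then 2 else 1) else 0 := by
  rcases (by omega : i = 0 ∨ i = 1 ∨ 2 ≤ i) with rfl | rfl | h
  · simp; omega
  · by_cases h : l = 2
    · subst h; simp
    · simp (disch := omega) only [if_pos, if_neg, if_true, if_false]
      norm_num
  · by_cases h' : i = l - 1
    · simp (disch := omega) only [if_pos, if_neg, if_true, if_false]
      norm_num
    · simp (disch := omega) only [if_pos, if_neg, if_true, if_false]
      norm_num

lemma qD {m i : ℕ} (h2 : 3 ≤ m) (hi : i < m) (C : ℕ → ℤ) (hC : C = fun j => if j = 0 then 1 else if j ≤ m - 3 then 2 else 1) :  2 * C i + (if 1 ≤ (i : ℕ) then (if (i : ℕ) ≤ m - 2 then -1 else 0) * C (i - 1) else 0) +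
      (if (i : ℕ) + 1 < m then (if (i : ℕ) + 1 ≤ m - 2 then -1 else 0) * C (i + 1) else 0) +
      (if (i : ℕ) = m - 1 then -1 else if (i : ℕ) = m - 3 then -1 else 0) *
        C (if (i : ℕ) = m - 1 then m - 3 else m - 1) = if i = 1 then 1 else if i = 2 ∧ m = 3 then 1 else 0 := by
  rcases (by omega : m = 3 ∨ m = 4 ∨ m = 5 ∨ 6 ≤ m) with rfl | rfl | rfl | h
  · rw [hC]; interval_cases i <;> simp
  · rw [hC]; interval_cases i <;> simp
  · rw [hC]; interval_cases i <;> simp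
  · have c0 : C 0 = 1 := by simp [hC]
    have c1 : ∀ j, 1 ≤ j → j ≤ m - 3 → C j = 2 := fun j h1 h2 => by
      rw [hC]; simp (disch := omega) only [if_pos, if_neg]
    have c2 : ∀ j, m - 2 ≤ j → C j = 1 := fun j h1 => by
      rw [hC]; simp (disch := omega) only [if_pos, if_neg]
    clear hC
    rcases (by omega : i = 0 ∨ i = 1 ∨ (2 ≤ i ∧ i ≤ m - 4) ∨ i = m - 3 ∨ i = m - 2 ∨ i = m - 1) with rfl | rfl | h' | rfl | rfl | rfl <;>
    simp (disch := omega) only [if_pos, if_neg, if_true, if_false, c0, c1, c2, Nat.sub_self] <;> norm_num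

end RootSystemData

namespace RootSystemData

section types

variable (P : RootSystemData k V)

lemma sub_type {m m' : ℕ} {A : Fin m → Fin m → ℤ} {e : Fin m → V}
    (he : Function.Injective e) (hA : ∀ i j, P.pairInt (e i) (e j) = A i j)
    {A' : Fin m' → Fin m' → ℤ} (f : Fin m' → Fin m) (hf : Function.Injective f)
    (T : Finset (Fin m)) (hT : ∀ i, i ∈ T ↔ ∃ j, f j = i)
    (h : ∀ i j, A (f i) (f j) = A' i j) : P.HasCartanType A' (Finset.image e T) := by
  refine ⟨e ∘ f, he.comp hf, ?_, fun i j => by rw [← h]; exact hA _ _⟩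
  ext x
  simp only [Finset.mem_image, Finset.mem_univ, true_and, Function.comp, hT]
  constructor
  · rintro ⟨j, rfl⟩
    exact ⟨f j, ⟨j, rfl⟩, rfl⟩
  · rintro ⟨i, ⟨j, rfl⟩, rfl⟩
    exact ⟨j, rfl⟩

lemma cc_union_image {m : ℕ} {A : Fin m → Fin m → ℤ} {e : Fin m → V}
    (he : Function.Injective e) (hA : ∀ i j, P.pairInt (e i) (e j) = A i j)
    {T T1 T2 : Finset (Fin m)} (hT : T = T1 ∪ T2) (hd : Disjoint T1 T2)
    (h : ∀ i ∈ T1, ∀ j ∈ T2, A i j = 0 ∧ A j i = 0) {r s : ℕ}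
    (h1 : P.CC (Finset.image e T1) r) (h2 : P.CC (Finset.image e T2) s) :
    P.CC (Finset.image e T) (r + s) := by
  rw [hT, Finset.image_union]
  refine P.cc_union ((Finset.disjoint_image he).2 hd) ?_ ?_ h1 h2
  · intro a ha b hb
    obtain ⟨i, hi, rfl⟩ := Finset.mem_image.1 ha
    obtain ⟨j, hj, rfl⟩ := Finset.mem_image.1 hb
    rw [hA, (h i hi j hj).1]
  · intro a ha b hb
    obtain ⟨i, hi, rfl⟩ := Finset.mem_image.1 ha
    obtain ⟨j, hj, rfl⟩ := Finset.mem_image.1 hb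
    rw [hA, (h j hj i hi).2]

lemma image_sub {m : ℕ} {Δ S : Finset V} {e : Fin m → V} (hS : Finset.image e Finset.univ = S)
    (hSD : S ⊆ Δ) : ∀ i, e i ∈ Δ := fun i => hSD (by rw [← hS]; simp)

lemma image_sub' {m : ℕ} {Δ : Finset V} {e : Fin m → V} (h : ∀ i, e i ∈ Δ) (T : Finset (Fin m)) :
    Finset.image e T ⊆ Δ := by
  intro x hx
  obtain ⟨i, _, rfl⟩ := Finset.mem_image.1 hx
  exact h i

variable {Δ : Finset V} (hbase : P.IsBase Δ)
include hbase

theorem cc_A : ∀ (l : ℕ) (S : Finset V), S ⊆ Δ → P.HasCartanType (cartanA l) S →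
    P.CC S ((l + 1) / 2) := by
  intro l
  induction l using Nat.strong_induction_on with
  | _ l ih =>
  intro S hSD hty
  obtain ⟨e, he, hS, hA⟩ := hty
  have heD := image_sub hS hSD
  rcases Nat.eq_zero_or_pos l with rfl | hl
  · have : S = ∅ := by rw [← hS]; simp
    rw [this]
    exact P.cc_empty
  have hcc := P.cc_step hbase he heD hA hS (fun _ => 1) (fun _ => by norm_num)
    (fun i j => by
      have := i.2
      have := j.2
      unfold cartanA
      split_ifs <;> omega)
    ⟨0, hl⟩ (fun _ => le_refl _) _ (reach_A hl (l - 1) (by omega))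
    (fun i => by
      have := i.2
      beta_reduce
      split_ifs <;> omega)
    (fun i => (if (i : ℕ) = 0 then 1 else 0) + if (i : ℕ) = l - 1 then 1 else 0)
    (fun i => by
      rw [sum_A (fun j : ℕ => if j ≤ l - 1 then (1 : ℤ) else 0)]
      have := i.2
      split_ifs <;> omega)
    (fun i => by split_ifs <;> omega) ⟨0, hl⟩ (by simp; split_ifs <;> omega)
    (r := (l - 2 + 1) / 2) ?_
  · rcases Nat.lt_or_ge l 2 with h2 | h2
    · have : l = 1 := by omega
      subst this
      exact hcc
    · have : (l + 1) / 2 = (l - 2 + 1) / 2 + 1 := by omega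
      rw [this]
      exact hcc
  · refine ih (l - 2) (by omega) _ (image_sub' heD _) ?_
    refine P.sub_type he hA (fun j => ⟨j + 1, by have := j.2; omega⟩) ?_ _ ?_ ?_
    · intro a b hab
      simp only [Fin.ext_iff] at hab ⊢
      omega
    · intro i
      have := i.2
      simp only [Finset.mem_filter, Finset.mem_univ, true_and, Fin.ext_iff]
      constructor
      · intro h
        refine ⟨⟨i - 1, ?_⟩, ?_⟩
        · split_ifs at h <;> omega
        · simp only
          split_ifs at h <;> omega
      · rintro ⟨j, hj⟩
        have := j.2
        split_ifs <;> omega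
    · intro i j
      simp only [cartanA]
      split_ifs <;> omega

theorem cc_C : ∀ (l : ℕ) (S : Finset V), S ⊆ Δ → P.HasCartanType (cartanC l) S →
    P.CC S l := by
  intro l
  induction l with
  | zero =>
    rintro S hSD ⟨e, he, hS, hA⟩
    have : S = ∅ := by rw [← hS]; simp
    rw [this]
    exact P.cc_empty
  | succ l ih =>
  intro S hSD hty
  obtain ⟨e, he, hS, hA⟩ := hty
  have heD := image_sub hS hSD
  refine P.cc_step hbase he heD hA hS (fun i => if (i : ℕ) = l then 2 else 1)
    (fun i => by split_ifs <;> norm_num)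
    (fun i j => by
      have := i.2
      have := j.2
      simp only [cartanC, cartanB]
      split_ifs <;> omega)
    ⟨l, by omega⟩ (fun i => by split_ifs <;> simp_all) _ (reach_C (by omega) l (by omega))
    (fun i => by
      have := i.2
      beta_reduce
      split_ifs <;> omega)
    (fun i => if (i : ℕ) = 0 then 2 else 0)
    (fun i => by
      rw [sum_C (fun j : ℕ => if j < l + 1 - 1 - l then (0 : ℤ) else if j < l + 1 - 1 then 2 else 1)]
      have := i.2
      simp only [Nat.add_sub_cancel, Nat.sub_self, Nat.not_lt_zero, if_false]
      split_ifs <;> omega)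
    (fun i => by split_ifs <;> omega) ⟨0, by omega⟩ (by simp) ?_
  refine ih _ (image_sub' heD _) ?_
  refine P.sub_type he hA (fun j => ⟨j + 1, by have := j.2; omega⟩) ?_ _ ?_ ?_
  · intro a b hab
    simp only [Fin.ext_iff] at hab ⊢
    omega
  · intro i
    have := i.2
    simp only [Finset.mem_filter, Finset.mem_univ, true_and, Fin.ext_iff]
    constructor
    · intro h
      refine ⟨⟨i - 1, ?_⟩, ?_⟩
      · split_ifs at h <;> omega
      · simp only
        split_ifs at h <;> omega
    · rintro ⟨j, hj⟩
      have := j.2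
      split_ifs <;> omega
  · intro i j
    have := i.2
    have := j.2
    simp only [cartanC, cartanB]
    split_ifs <;> omega

/-- A single node contributes one element. -/
lemma cc_single {m : ℕ} {A : Fin m → Fin m → ℤ} {e : Fin m → V}
    (he : Function.Injective e) (heD : ∀ i, e i ∈ Δ)
    (hA : ∀ i j, P.pairInt (e i) (e j) = A i j) (i : Fin m) (hi : A i i = 2) :
    P.CC (Finset.image e {i}) 1 := by
  refine P.cc_A hbase 1 _ (image_sub' heD _) ?_
  refine P.sub_type he hA (fun _ => i) (fun a b _ => Subsingleton.elim a b) _ ?_ ?_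
  · intro j
    simp [eq_comm]
  · intro a b
    have : a = b := Subsingleton.elim a b
    subst this
    simp [cartanA, hi]

theorem cc_B : ∀ (l : ℕ) (S : Finset V), S ⊆ Δ → P.HasCartanType (cartanB l) S →
    P.CC S l := by
  intro l
  induction l using Nat.strong_induction_on with
  | _ l ih =>
  intro S hSD hty
  obtain ⟨e, he, hS, hA⟩ := hty
  have heD := image_sub hS hSD
  rcases Nat.eq_zero_or_pos l with rfl | hl
  · have : S = ∅ := by rw [← hS]; simp
    rw [this]
    exact P.cc_empty
  rcases Nat.lt_or_ge l 2 with h2 | h2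
  · have : l = 1 := by omega
    subst this
    rw [← hS]
    exact P.cc_single hbase he heD hA 0 (by simp [cartanB])
  have hcc := P.cc_step hbase he heD hA hS (fun i => if (i : ℕ) = l - 1 then 1 else 2)
    (fun i => by split_ifs <;> norm_num)
    (fun i j => by
      have := i.2
      have := j.2
      simp only [cartanB]
      split_ifs <;> omega)
    ⟨l - 2, by omega⟩ (fun i => by split_ifs <;> simp_all <;> omega) _
    (reach_B h2 (l - 2) (by omega))
    (fun i => by
      have := i.2
      beta_reduce
      split_ifs <;> omega)
    (fun i => if (i : ℕ) = 1 then (if l = 2 then 2 else 1) else 0)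
    (fun i => by
      rw [sum_B (fun j : ℕ => if j < l - 2 - (l - 2) then (0 : ℤ) else
        if j = l - 2 - (l - 2) then 1 else 2)]
      obtain ⟨i, hi⟩ := i
      simp only [Nat.sub_self, Nat.not_lt_zero, if_false]
      exact qB h2 hi)
    (fun i => by split_ifs <;> omega) ⟨1, by omega⟩ (by simp; split_ifs <;> omega)
    (r := 1 + (l - 2)) ?_
  · have : l = 1 + (l - 2) + 1 := by omega
    rw [this]
    exact hcc
  · refine P.cc_union_image he hA (T1 := {⟨0, by omega⟩})
      (T2 := Finset.univ.filter fun i => 2 ≤ (i : ℕ)) ?_ ?_ ?_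
      (P.cc_single hbase he heD hA _ (by simp [cartanB]))
      (ih (l - 2) (by omega) _ (image_sub' heD _) ?_)
    · ext i
      simp only [Finset.mem_filter, Finset.mem_univ, true_and, Finset.mem_union,
        Finset.mem_singleton, Fin.ext_iff]
      split_ifs <;> omega
    · simp
    · intro i hi j hj
      simp only [Finset.mem_filter, Finset.mem_univ, true_and,
        Finset.mem_singleton, Fin.ext_iff] at hi hj
      simp only [cartanB]
      constructor <;> (split_ifs <;> omega)
    · refine P.sub_type he hA (fun j => ⟨j + 2, by have := j.2; omega⟩) ?_ _ ?_ ?_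
      · intro a b hab
        simp only [Fin.ext_iff] at hab ⊢
        omega
      · intro i
        have := i.2
        simp only [Finset.mem_filter, Finset.mem_univ, true_and, Fin.ext_iff]
        constructor
        · intro h
          exact ⟨⟨i - 2, by omega⟩, by simp only; omega⟩
        · rintro ⟨j, hj⟩
          omega
      · intro i j
        have := i.2
        have := j.2
        simp only [cartanB]
        split_ifs <;> omega

theorem cc_D : ∀ (l : ℕ), 3 ≤ l → ∀ (S : Finset V), S ⊆ Δ → P.HasCartanType (cartanD l) S →
    P.CC S (2 * (l / 2)) := by
  intro l
  induction l using Nat.strong_induction_on with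
  | _ l ih =>
  intro h3 S hSD hty
  obtain ⟨e, he, hS, hA⟩ := hty
  have heD := image_sub hS hSD
  have hcc := P.cc_step hbase he heD hA hS (fun i => 1)
    (fun i => by norm_num)
    (fun i j => by
      simp only [cartanD]
      split_ifs <;> omega)
    ⟨l - 3, by omega⟩ (fun i => le_refl _) _
    (reach_D h3 (l - 3) (by omega))
    (fun i => by
      have := i.2
      beta_reduce
      split_ifs <;> omega)
    (fun i => if (i : ℕ) = 1 then 1 else if (i : ℕ) = 2 ∧ l = 3 then 1 else 0)
    (fun i => by
      rw [sum_D h3 (fun j : ℕ => if j < l - 3 - (l - 3) then (0 : ℤ) else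
        if j = l - 3 - (l - 3) then 1 else if j ≤ l - 3 then 2 else 1)]
      obtain ⟨i, hi⟩ := i
      simp only [Nat.sub_self, Nat.not_lt_zero, if_false]
      exact qD h3 hi _ rfl)
    (fun i => by split_ifs <;> omega) ⟨1, by omega⟩ (by simp)
    (r := 1 + 2 * ((l - 2) / 2)) ?_
  · have : 2 * (l / 2) = 1 + 2 * ((l - 2) / 2) + 1 := by omega
    rw [this]
    exact hcc
  · refine P.cc_union_image he hA (T1 := {⟨0, by omega⟩})
      (T2 := Finset.univ.filter fun i => 2 ≤ (i : ℕ) ∧ l ≠ 3) ?_ ?_ ?_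
      (P.cc_single hbase he heD hA _ (by simp [cartanD])) ?_
    · ext i
      have := i.2
      simp only [Finset.mem_filter, Finset.mem_univ, true_and, Finset.mem_union,
        Finset.mem_singleton, Fin.ext_iff]
      split_ifs <;> omega
    · simp
    · intro i hi j hj
      simp only [Finset.mem_filter, Finset.mem_univ, true_and,
        Finset.mem_singleton, Fin.ext_iff] at hi hj
      simp only [cartanD]
      constructor <;> (split_ifs <;> omega)
    · rcases (by omega : l = 3 ∨ l = 4 ∨ 5 ≤ l) with rfl | rfl | h5
      · simpa using P.cc_empty
      · change P.CC _ (1 + 1)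
        refine P.cc_union_image he hA (T1 := {2}) (T2 := {3}) (by decide) (by decide) (by decide)
          (P.cc_single hbase he heD hA 2 (by decide))
          (P.cc_single hbase he heD hA 3 (by decide))
      · refine ih (l - 2) (by omega) (by omega) _ (image_sub' heD _) ?_
        refine P.sub_type he hA (fun j => ⟨j + 2, by have := j.2; omega⟩) ?_ _ ?_ ?_
        · intro a b hab
          simp only [Fin.ext_iff] at hab ⊢
          omega
        · intro i
          have := i.2
          simp only [Finset.mem_filter, Finset.mem_univ, true_and, Fin.ext_iff]
          constructor
          · intro h
            exact ⟨⟨i - 2, by omega⟩, by simp only; omega⟩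
          · rintro ⟨j, hj⟩
            omega
        · intro i j
          have := i.2
          have := j.2
          simp only [cartanD]
          split_ifs <;> omega

theorem cc_E6 (S : Finset V) (hSD : S ⊆ Δ) (hty : P.HasCartanType (cartanE 6) S) :
    P.CC S 4 := by
  obtain ⟨e, he, hS, hA⟩ := hty
  have heD := image_sub hS hSD
  refine P.cc_step hbase he heD hA hS (fun i => 1) (fun i => by norm_num) (by decide)
    _ (fun i => le_refl _) _ reach_E6 (by decide) ![0, 1, 0, 0, 0, 0] (by decide +kernel)
    (by decide) 1 (by decide) (P.cc_A hbase 5 _ (image_sub' heD _) ?_)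
  exact P.sub_type he hA ![0, 2, 3, 4, 5] (by decide) _ (by decide) (by decide)

theorem cc_E7 (S : Finset V) (hSD : S ⊆ Δ) (hty : P.HasCartanType (cartanE 7) S) :
    P.CC S 7 := by
  obtain ⟨e, he, hS, hA⟩ := hty
  have heD := image_sub hS hSD
  refine P.cc_step hbase he heD hA hS (fun i => 1) (fun i => by norm_num) (by decide)
    _ (fun i => le_refl _) _ reach_E7 (by decide) ![1, 0, 0, 0, 0, 0, 0] (by decide +kernel)
    (by decide) 0 (by decide) (P.cc_D hbase 6 (by norm_num) _ (image_sub' heD _) ?_)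
  exact P.sub_type he hA ![6, 5, 4, 3, 1, 2] (by decide) _ (by decide) (by decide)

theorem cc_E8 (S : Finset V) (hSD : S ⊆ Δ) (hty : P.HasCartanType (cartanE 8) S) :
    P.CC S 8 := by
  obtain ⟨e, he, hS, hA⟩ := hty
  have heD := image_sub hS hSD
  refine P.cc_step hbase he heD hA hS (fun i => 1) (fun i => by norm_num) (by decide +kernel)
    _ (fun i => le_refl _) _ reach_E8 (by decide) ![0, 0, 0, 0, 0, 0, 0, 1] (by decide +kernel)
    (by decide) 7 (by decide) (P.cc_E7 hbase _ (image_sub' heD _) ?_)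
  exact P.sub_type he hA ![0, 1, 2, 3, 4, 5, 6] (by decide) _ (by decide) (by decide)

theorem cc_F4 (S : Finset V) (hSD : S ⊆ Δ) (hty : P.HasCartanType cartanF S) :
    P.CC S 4 := by
  obtain ⟨e, he, hS, hA⟩ := hty
  have heD := image_sub hS hSD
  refine P.cc_step hbase he heD hA hS ![2, 2, 1, 1] (by decide) (by decide)
    _ (by decide) _ reach_F4 (by decide) ![1, 0, 0, 0] (by decide +kernel)
    (by decide) 0 (by decide) (P.cc_C hbase 3 _ (image_sub' heD _) ?_)
  exact P.sub_type he hA ![3, 2, 1] (by decide) _ (by decide) (by decide)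

theorem cc_G2 (S : Finset V) (hSD : S ⊆ Δ) (hty : P.HasCartanType cartanG S) :
    P.CC S 2 := by
  obtain ⟨e, he, hS, hA⟩ := hty
  have heD := image_sub hS hSD
  refine P.cc_step hbase he heD hA hS ![1, 3] (by decide) (by decide)
    _ (by decide) _ reach_G2 (by decide) ![0, 1] (by decide +kernel)
    (by decide) 1 (by decide) (P.cc_A hbase 1 _ (image_sub' heD _) ?_)
  exact P.sub_type he hA ![0] (by decide) _ (by decide) (by decide)

end types

end RootSystemData

/-- Let `R` be a reduced irreducible root system with base `Π` and let
`k = |𝒦(Π)|` be the cardinality of the cascade.  Then: for type `A_l` (`l ≥ 1`),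
`k = ⌊(l+1)/2⌋`; for type `B_l` (`l ≥ 2`), `k = l`; for type `C_l` (`l ≥ 3`), `k = l`;
for type `D_l` (`l ≥ 4`), `k = 2⌊l/2⌋`; for type `E_6`, `k = 4`; for type `E_7`, `k = 7`;
for type `E_8`, `k = 8`; for type `F_4`, `k = 4`; for type `G_2`, `k = 2`. -/
theorem cascade_card_eq_of_type
    (P : RootSystemData k V) (Δ : Finset V) (hbase : P.IsBase Δ) (hirr : P.IsConnected Δ) :
    (∀ l : ℕ, 1 ≤ l → P.HasCartanType (cartanA l) Δ → (P.cascade Δ).card = (l + 1) / 2) ∧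
    (∀ l : ℕ, 2 ≤ l → P.HasCartanType (cartanB l) Δ → (P.cascade Δ).card = l) ∧
    (∀ l : ℕ, 3 ≤ l → P.HasCartanType (cartanC l) Δ → (P.cascade Δ).card = l) ∧
    (∀ l : ℕ, 4 ≤ l → P.HasCartanType (cartanD l) Δ → (P.cascade Δ).card = 2 * (l / 2)) ∧
    (P.HasCartanType (cartanE 6) Δ → (P.cascade Δ).card = 4) ∧
    (P.HasCartanType (cartanE 7) Δ → (P.cascade Δ).card = 7) ∧
    (P.HasCartanType (cartanE 8) Δ → (P.cascade Δ).card = 8) ∧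
    (P.HasCartanType cartanF Δ → (P.cascade Δ).card = 4) ∧
    (P.HasCartanType cartanG Δ → (P.cascade Δ).card = 2) := by
  have key : ∀ r, P.CC Δ r → (P.cascade Δ).card = r := fun r h => h _ (Nat.le_succ _)
  have hs := Finset.Subset.refl Δ
  exact ⟨fun l _ h => key _ (P.cc_A hbase l Δ hs h), fun l _ h => key _ (P.cc_B hbase l Δ hs h),
    fun l _ h => key _ (P.cc_C hbase l Δ hs h),
    fun l hl h => key _ (P.cc_D hbase l (by omega) Δ hs h),
    fun h => key _ (P.cc_E6 hbase Δ hs h), fun h => key _ (P.cc_E7 hbase Δ hs h),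
    fun h => key _ (P.cc_E8 hbase Δ hs h), fun h => key _ (P.cc_F4 hbase Δ hs h),
    fun h => key _ (P.cc_G2 hbase Δ hs h)⟩
end

section
/- Let 𝔤 be a finite-dimensional semisimple Lie algebra over an algebraically closed field k of characteristic 0, with Cartan subalgebra 𝔥, root system R, base Π, positive roots R_+, 𝔫 = ⊕_{α ∈ R_+} 𝔤^α, and 𝔟 = 𝔥 ⊕ 𝔫. Fix nonzero root vectors X_α ∈ 𝔤^α for all α ∈ R, and set u = Σ_{K ∈ 𝒦} X_{−ε_K} where 𝒦 = 𝒦(Π). Then for x ∈ 𝔟, the following are equivalent: (i) x ∈ 𝔥 and ε_K(x) = 0 for all K ∈ 𝒦; (ii) [x, u] ∈ 𝔫. -/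
open Finset Module

open scoped Classical

set_option linter.unusedSectionVars false
set_option linter.unusedVariables false

namespace RootSystemData

variable {k V : Type*} [Field k] [CharZero k] [AddCommGroup V] [Module k V]

/-- Standard facts about pairings of roots. -/
structure Good (P : RootSystemData k V) : Prop where
  sub : ∀ α ∈ P.roots, ∀ β ∈ P.roots, 0 < P.pairInt α β → α ≠ β → α - β ∈ P.roots
  add : ∀ α ∈ P.roots, ∀ β ∈ P.roots, P.pairInt α β < 0 → α ≠ -β → α + β ∈ P.roots
  zero : ∀ α ∈ P.roots, ∀ β ∈ P.roots, P.pairInt α β = 0 → P.pairInt β α = 0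

/-- The monoid `ℕS`. -/
abbrev cl (S : Finset V) : AddSubmonoid V := AddSubmonoid.closure (S : Set V)

/-- Coordinates in a base. -/
noncomputable def co (Δ : Finset V) (v : V) : V → ℕ :=
  if h : v ∈ cl Δ then (AddSubmonoid.mem_closure_finset.1 h).choose else 0

theorem co_sum {Δ : Finset V} {v : V} (h : v ∈ cl Δ) : ∑ a ∈ Δ, co Δ v a • a = v := by
  unfold co
  rw [dif_pos h]
  exact (AddSubmonoid.mem_closure_finset.1 h).choose_spec.2

theorem cl_mono {S T : Finset V} (h : S ⊆ T) : cl S ≤ cl T :=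
  AddSubmonoid.closure_mono (by exact_mod_cast h)

theorem mem_cl {S : Finset V} {a : V} (h : a ∈ S) : a ∈ cl S :=
  AddSubmonoid.subset_closure (by exact_mod_cast h)

theorem neg_mem_roots {P : RootSystemData k V} {α : V} (h : α ∈ P.roots) : -α ∈ P.roots := by
  have := P.reflect_mem α h α h
  rw [P.pair_self α h] at this
  convert this using 1
  rw [two_zsmul]; abel

theorem pair_add {P : RootSystemData k V} {ε α β : V} (hε : ε ∈ P.roots) (hα : α ∈ P.roots) (hβ : β ∈ P.roots)
    (h : α + β ∈ P.roots) : P.pairInt (α + β) ε = P.pairInt α ε + P.pairInt β ε := by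
  have h : (P.pairInt (α + β) ε : k) = ((P.pairInt α ε + P.pairInt β ε : ℤ) : k) := by
    push_cast
    rw [P.pair_compat ε hε _ h, P.pair_compat ε hε _ hα, P.pair_compat ε hε _ hβ, map_add]
  exact_mod_cast h

section base

variable {P : RootSystemData k V} {Δ : Finset V}

theorem coef_unique (hb : P.IsBase Δ) {f g : V → ℕ} (h : ∑ a ∈ Δ, f a • a = ∑ a ∈ Δ, g a • a) :
    ∀ a ∈ Δ, f a = g a := by
  have hi := hb.indep
  rw [Fintype.linearIndependent_iff] at hi
  intro a ha
  have := hi (fun b => (f b : k) - g b) (by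
    simp only [sub_smul, Finset.sum_sub_distrib, Nat.cast_smul_eq_nsmul]
    rw [Finset.sum_coe_sort Δ (fun b => f b • b), Finset.sum_coe_sort Δ (fun b => g b • b), h,
      sub_self]) ⟨a, ha⟩
  simpa [sub_eq_zero] using this

theorem co_add (hb : P.IsBase Δ) {v w : V} (hv : v ∈ cl Δ) (hw : w ∈ cl Δ) {a : V} (ha : a ∈ Δ) :
    co Δ (v + w) a = co Δ v a + co Δ w a := by
  refine coef_unique hb (f := co Δ (v + w)) (g := fun a => co Δ v a + co Δ w a) ?_ a ha
  simp only [add_smul, Finset.sum_add_distrib]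
  rw [co_sum (add_mem hv hw), co_sum hv, co_sum hw]

theorem co_zero (hb : P.IsBase Δ) {a : V} (ha : a ∈ Δ) : co Δ (0 : V) a = 0 := by
  have := co_add hb (zero_mem (cl Δ)) (zero_mem (cl Δ)) ha
  rw [add_zero] at this
  omega

theorem co_single (hb : P.IsBase Δ) {a : V} (ha : a ∈ Δ) {b : V} (hbΔ : b ∈ Δ) :
    co Δ a b = if b = a then 1 else 0 := by
  refine coef_unique hb (f := co Δ a) (g := fun b => if b = a then 1 else 0) ?_ b hbΔ
  rw [co_sum (mem_cl ha)]
  simp [ha]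

theorem mem_cl_iff (hb : P.IsBase Δ) {S : Finset V} (hS : S ⊆ Δ) {v : V} :
    v ∈ cl S ↔ v ∈ cl Δ ∧ ∀ a ∈ Δ, a ∉ S → co Δ v a = 0 := by
  constructor
  · intro h
    refine ⟨cl_mono hS h, ?_⟩
    intro a ha haS
    refine AddSubmonoid.closure_induction (motive := fun v _ => co Δ v a = 0) ?_ ?_ ?_ h
    · intro x hx
      have hx : x ∈ S := by exact_mod_cast hx
      rw [co_single hb (hS hx) ha, if_neg]
      rintro rfl
      exact haS hx
    · exact co_zero hb ha
    · intro x y hx hy h1 h2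
      rw [co_add hb (cl_mono hS hx) (cl_mono hS hy) ha, h1, h2]
  · rintro ⟨h, h0⟩
    rw [← co_sum h]
    refine sum_mem fun a ha => ?_
    by_cases haS : a ∈ S
    · exact nsmul_mem (mem_cl haS) _
    · rw [h0 a ha haS, zero_smul]; exact zero_mem _

theorem mem_of_add (hb : P.IsBase Δ) {S : Finset V} (hS : S ⊆ Δ) {v w : V} (hv : v ∈ cl Δ) (hw : w ∈ cl Δ)
    (h : v + w ∈ cl S) : v ∈ cl S := by
  rw [mem_cl_iff hb hS] at h ⊢
  refine ⟨hv, fun a ha haS => ?_⟩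
  have := h.2 a ha haS
  rw [co_add hb hv hw ha] at this
  omega

theorem eq_zero_of_co (hb : P.IsBase Δ) {v : V} (h : v ∈ cl Δ) (h0 : ∀ a ∈ Δ, co Δ v a = 0) : v = 0 := by
  rw [← co_sum h]
  exact Finset.sum_eq_zero fun a ha => by rw [h0 a ha, zero_smul]

theorem eq_zero_of_neg (hb : P.IsBase Δ) {v : V} (hv : v ∈ cl Δ) (hw : -v ∈ cl Δ) : v = 0 := by
  refine eq_zero_of_co hb hv fun a ha => ?_
  have := co_add hb hv hw ha
  rw [add_neg_cancel, co_zero hb ha] at this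
  omega

theorem sub_not_root (hb : P.IsBase Δ) {A B : Finset V} (hA : A ⊆ Δ) (hB : B ⊆ Δ) (hd : ∀ a ∈ A, a ∉ B)
    {β γ : V} (hβ : β ∈ cl A) (hγ : γ ∈ cl B) (hβ0 : β ≠ 0) (hγ0 : γ ≠ 0) :
    β - γ ∉ P.roots := by
  have key : ∀ v, v ∈ cl A → v ∈ cl B → v = 0 := by
    intro v h1 h2
    rw [mem_cl_iff hb hA] at h1
    rw [mem_cl_iff hb hB] at h2
    refine eq_zero_of_co hb h1.1 fun a ha => ?_
    by_cases haA : a ∈ A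
    · exact h2.2 a ha (hd a haA)
    · exact h1.2 a ha haA
  intro h
  rcases hb.pos_or_neg _ h with h | h
  · refine hγ0 (key γ (mem_of_add hb hA (cl_mono hB hγ) h ?_) hγ)
    convert hβ using 1; abel
  · refine hβ0 (key β hβ (mem_of_add hb hB (cl_mono hA hβ) h ?_))
    convert hγ using 1; abel

theorem simple_pair_nonpos (hb : P.IsBase Δ) (G : P.Good) {a b : V} (ha : a ∈ Δ) (hbΔ : b ∈ Δ) (hab : a ≠ b) :
    P.pairInt a b ≤ 0 := by
  by_contra h
  push Not at h
  have haR := hb.subset ha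
  have hbR := hb.subset hbΔ
  refine sub_not_root hb (A := {a}) (B := {b}) (by simpa using ha) (by simpa using hbΔ)
    (by simpa using hab) (mem_cl (by simp)) (mem_cl (by simp))
    (P.ne_zero a haR) (P.ne_zero b hbR) (G.sub a haR b hbR h hab)

theorem pair_sum (hb : P.IsBase Δ) {ε α : V} (hε : ε ∈ P.roots) (hα : α ∈ P.roots) (hp : α ∈ cl Δ) :
    P.pairInt α ε = ∑ a ∈ Δ, (co Δ α a : ℤ) * P.pairInt a ε := by
  have h : (P.pairInt α ε : k) = ((∑ a ∈ Δ, (co Δ α a : ℤ) * P.pairInt a ε : ℤ) : k) := by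
    rw [P.pair_compat ε hε α hα]
    conv_lhs => rw [← co_sum hp]
    rw [map_sum]
    push_cast
    refine Finset.sum_congr rfl fun a ha => ?_
    rw [map_nsmul, P.pair_compat ε hε a (hb.subset ha), nsmul_eq_mul]
  exact_mod_cast h

theorem pair_eq_zero (hb : P.IsBase Δ) {S : Finset V} (hS : S ⊆ Δ) {ε α : V} (hε : ε ∈ P.roots) (hα : α ∈ P.roots)
    (hp : α ∈ cl S) (h0 : ∀ a ∈ S, P.pairInt a ε = 0) : P.pairInt α ε = 0 := by
  rw [pair_sum hb hε hα (cl_mono hS hp)]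
  refine Finset.sum_eq_zero fun a ha => ?_
  by_cases haS : a ∈ S
  · rw [h0 a haS, mul_zero]
  · rw [((mem_cl_iff hb hS).1 hp).2 a ha haS]; simp

/-- height -/
noncomputable def ht (Δ : Finset V) (v : V) : ℕ := ∑ a ∈ Δ, co Δ v a

theorem ht_add (hb : P.IsBase Δ) {v w : V} (hv : v ∈ cl Δ) (hw : w ∈ cl Δ) : ht Δ (v + w) = ht Δ v + ht Δ w := by
  unfold ht
  rw [← Finset.sum_add_distrib]
  exact Finset.sum_congr rfl fun a ha => co_add hb hv hw ha

theorem eq_zero_of_ht (hb : P.IsBase Δ) {v : V} (hv : v ∈ cl Δ) (h : ht Δ v = 0) : v = 0 :=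
  eq_zero_of_co hb hv fun a ha => by
    unfold ht at h
    exact (Finset.sum_eq_zero_iff.1 h) a ha

/-- Connectedness through absence of splittings. -/
def Conn (P : RootSystemData k V) (C : Finset V) : Prop :=
  C.Nonempty ∧ ∀ T ⊆ C, T.Nonempty → (∀ t ∈ T, ∀ c ∈ C, c ∉ T → P.pairInt t c = 0) → T = C

/-- maximal positive root of `R^C` -/
def IsMax (P : RootSystemData k V) (C : Finset V) (ε : V) : Prop :=
  ε ∈ P.roots ∧ ε ∈ cl C ∧ ∀ γ ∈ P.roots, γ ∈ cl C → γ - ε ∈ cl C → γ = ε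

theorem exists_isMax (hb : P.IsBase Δ) {C : Finset V} (hC : C ⊆ Δ) {α : V} (hα : α ∈ P.roots) (hp : α ∈ cl C) :
    ∃ ε, IsMax P C ε ∧ ε - α ∈ cl C := by
  obtain ⟨ε, hε, hmax⟩ := Finset.exists_max_image
    (P.roots.filter fun γ => γ ∈ cl C ∧ γ - α ∈ cl C) (ht Δ) ⟨α, by simp [hα, hp]⟩
  simp only [Finset.mem_filter] at hε hmax
  refine ⟨ε, ⟨hε.1, hε.2.1, ?_⟩, hε.2.2⟩
  intro γ hγ hγC hsub
  have h1 := hmax γ ⟨hγ, hγC, by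
    have := add_mem hsub hε.2.2
    convert this using 1; abel⟩
  have h2 := ht_add hb (cl_mono hC hsub) (cl_mono hC hε.2.1)
  rw [sub_add_cancel] at h2
  have h3 := eq_zero_of_ht hb (cl_mono hC hsub) (by omega)
  exact sub_eq_zero.1 h3

theorem IsMax.add_not (hb : P.IsBase Δ) {C : Finset V} {ε : V} (hC : C ⊆ Δ) (h : IsMax P C ε) {α : V}
    (hα : α ∈ P.roots) (hp : α ∈ cl C) : α + ε ∉ P.roots := by
  intro hs
  have := h.2.2 _ hs (add_mem hp h.2.1) (by simpa using hp)
  exact P.ne_zero α hα (by simpa using this)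

theorem ne_neg (hb : P.IsBase Δ) {α β : V} (hα : α ∈ P.roots) (hp : α ∈ cl Δ) (hq : β ∈ cl Δ) :
    α ≠ -β := by
  intro h
  refine P.ne_zero α hα (eq_zero_of_neg hb hp ?_)
  rw [h, neg_neg]; exact hq

theorem IsMax.pair_nonneg (hb : P.IsBase Δ) (G : P.Good) {C : Finset V} {ε : V} (hC : C ⊆ Δ) (h : IsMax P C ε) {α : V}
    (hα : α ∈ P.roots) (hp : α ∈ cl C) : 0 ≤ P.pairInt α ε := by
  by_contra hlt
  push Not at hlt
  exact h.add_not hb hC hα hp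
    (G.add α hα ε h.1 hlt (ne_neg hb hα (cl_mono hC hp) (cl_mono hC h.2.1)))

theorem IsMax.full (hb : P.IsBase Δ) (G : P.Good) {C : Finset V} {ε : V} (hC : C ⊆ Δ) (hc : Conn P C)
    (h : IsMax P C ε) : ∀ a ∈ C, 0 < co Δ ε a := by
  have hεΔ := cl_mono hC h.2.1
  have key : (C.filter fun a => 0 < co Δ ε a) = C := by
    apply hc.2 _ (Finset.filter_subset _ _)
    · by_contra hne
      rw [Finset.not_nonempty_iff_eq_empty, Finset.filter_eq_empty_iff] at hne
      refine P.ne_zero ε h.1 (eq_zero_of_co hb hεΔ fun a ha => ?_)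
      by_cases haC : a ∈ C
      · have := hne haC; omega
      · exact ((mem_cl_iff hb hC).1 h.2.1).2 a ha haC
    · intro t ht d hd hdT
      simp only [Finset.mem_filter, not_and, not_lt, nonpos_iff_eq_zero] at ht hdT
      have hd0 := hdT hd
      by_contra hne
      have hdΔ := hC hd
      have hdR := hb.subset hdΔ
      have hneg : P.pairInt ε d < 0 := by
        rw [pair_sum hb hdR h.1 hεΔ]
        refine Finset.sum_neg' ?_ ⟨t, hC ht.1, ?_⟩
        · intro a ha
          by_cases had : a = d
          · rw [had, hd0]; simp
          · exact mul_nonpos_of_nonneg_of_nonpos (by positivity)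
              (simple_pair_nonpos hb G ha hdΔ had)
        · have htd : t ≠ d := by rintro rfl; omega
          have h1 := simple_pair_nonpos hb G (hC ht.1) hdΔ htd
          have h2 : P.pairInt t d < 0 := lt_of_le_of_ne h1 hne
          have h3 : (0 : ℤ) < co Δ ε t := by exact_mod_cast ht.2
          exact mul_neg_of_pos_of_neg h3 h2
      have := G.add ε h.1 d hdR hneg (ne_neg hb h.1 hεΔ (mem_cl hdΔ))
      rw [add_comm] at this
      exact h.add_not hb hC hdR (mem_cl hd) this
  intro a ha
  rw [← key, Finset.mem_filter] at ha
  exact ha.2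

theorem IsMax.unique (hb : P.IsBase Δ) (G : P.Good) {C : Finset V} {ε ε' : V} (hC : C ⊆ Δ) (hc : Conn P C)
    (h : IsMax P C ε) (h' : IsMax P C ε') : ε' = ε := by
  have hεΔ := cl_mono hC h.2.1
  have hεΔ' := cl_mono hC h'.2.1
  have hnn : ∀ (η : V), η ∈ cl C → ∀ a ∈ Δ, 0 ≤ (co Δ η a : ℤ) * P.pairInt a ε := by
    intro η hη a ha
    by_cases haC : a ∈ C
    · exact mul_nonneg (by positivity) (h.pair_nonneg hb G hC (hb.subset ha) (mem_cl haC))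
    · rw [((mem_cl_iff hb hC).1 hη).2 a ha haC]; simp
  have hex : ∃ a ∈ Δ, 0 < (co Δ ε a : ℤ) * P.pairInt a ε := by
    by_contra hcon
    push Not at hcon
    have := Finset.sum_nonpos hcon
    rw [← pair_sum hb h.1 h.1 hεΔ, P.pair_self ε h.1] at this
    omega
  obtain ⟨a, ha, hpos⟩ := hex
  have haC : a ∈ C := by
    by_contra haC
    rw [((mem_cl_iff hb hC).1 h.2.1).2 a ha haC] at hpos
    simp at hpos
  have hpa : 0 < P.pairInt a ε := by
    by_contra hcon
    push Not at hcon
    exact absurd hpos (not_lt.2 (mul_nonpos_of_nonneg_of_nonpos (by positivity) hcon))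
  have hpos' : 0 < P.pairInt ε' ε := by
    rw [pair_sum hb h.1 h'.1 hεΔ']
    refine Finset.sum_pos' (hnn ε' h'.2.1) ⟨a, ha, ?_⟩
    have : (0 : ℤ) < co Δ ε' a := by exact_mod_cast h'.full hb G hC hc a haC
    exact mul_pos this hpa
  by_contra hne
  have hr := G.sub ε' h'.1 ε h.1 hpos' hne
  rcases hb.pos_or_neg _ hr with hs | hs
  · exact hne (h.2.2 ε' h'.1 h'.2.1 (mem_of_add hb hC hs hεΔ (by simpa using h'.2.1)))
  · rw [neg_sub] at hs
    exact hne (h'.2.2 ε h.1 h.2.1 (mem_of_add hb hC hs hεΔ' (by simpa using h.2.1))).symm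

theorem mem_rootsOf_cases (hb : P.IsBase Δ) {C : Finset V} (hC : C ⊆ Δ) {α : V} (h : α ∈ P.rootsOf C) :
    α ∈ cl C ∨ -α ∈ cl C := by
  simp only [rootsOf, Finset.mem_filter] at h
  have : ∃ p ∈ cl C, ∃ q ∈ cl C, α = p - q := by
    refine AddSubgroup.closure_induction
      (p := fun α _ => ∃ p ∈ cl C, ∃ q ∈ cl C, α = p - q) ?_ ?_ ?_ ?_ h.2
    · intro x hx
      exact ⟨x, AddSubmonoid.subset_closure hx, 0, zero_mem _, by simp⟩
    · exact ⟨0, zero_mem _, 0, zero_mem _, by simp⟩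
    · rintro x y - - ⟨p, hp, q, hq, rfl⟩ ⟨p', hp', q', hq', rfl⟩
      exact ⟨p + p', add_mem hp hp', q + q', add_mem hq hq', by abel⟩
    · rintro x - ⟨p, hp, q, hq, rfl⟩
      exact ⟨q, hq, p, hp, by abel⟩
  obtain ⟨p, hp, q, hq, hpq⟩ := this
  rcases hb.pos_or_neg _ h.1 with hs | hs
  · left
    exact mem_of_add hb hC hs (cl_mono hC hq) (by rw [hpq]; simpa using hp)
  · right
    exact mem_of_add hb hC hs (cl_mono hC hp) (by rw [hpq]; simpa using hq)

theorem exists_highest (hb : P.IsBase Δ) (G : P.Good) {C : Finset V} (hC : C ⊆ Δ) (hc : Conn P C) :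
    ∃ ε, P.IsHighestRoot C ε := by
  obtain ⟨a, ha⟩ := hc.1
  obtain ⟨ε, hε, -⟩ := exists_isMax hb hC (hb.subset (hC ha)) (mem_cl ha)
  refine ⟨ε, ?_, ?_⟩
  · simp only [posRootsOf, Finset.mem_filter]
    exact ⟨hε.1, hε.2.1⟩
  · intro α hα
    rcases mem_rootsOf_cases hb hC hα with h | h
    · obtain ⟨ε', hε', hs⟩ := exists_isMax hb hC (Finset.mem_filter.1 hα).1 h
      rw [← hε.unique hb G hC hc hε']
      exact hs
    · rw [sub_eq_add_neg]
      exact add_mem hε.2.1 h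

theorem hr_isMax (hb : P.IsBase Δ) (G : P.Good) {C : Finset V} (hC : C ⊆ Δ) (hc : Conn P C) :
    IsMax P C (P.highestRoot C) ∧
      ∀ α ∈ P.roots, α ∈ cl C → P.highestRoot C - α ∈ cl C := by
  have hex := exists_highest hb G hC hc
  have hs : P.IsHighestRoot C (P.highestRoot C) := by
    unfold highestRoot
    rw [dif_pos hex]
    exact hex.choose_spec
  have hs1 := Finset.mem_filter.1 hs.1
  have key : ∀ α ∈ P.roots, α ∈ cl C → P.highestRoot C - α ∈ cl C := by
    intro α hα hp
    refine hs.2 α ?_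
    simp only [rootsOf, Finset.mem_filter]
    exact ⟨hα, AddSubmonoid.closure_le (S := (AddSubgroup.closure (C : Set V)).toAddSubmonoid).2
      AddSubgroup.subset_closure hp⟩
  refine ⟨⟨hs1.1, hs1.2, ?_⟩, key⟩
  intro γ hγ hγC hsub
  have h1 := key γ hγ hγC
  rw [← neg_sub] at h1
  exact sub_eq_zero.1 (eq_zero_of_neg hb (cl_mono hC hsub) (cl_mono hC h1))

/-! ### components -/

theorem linked_symm_s14 (hb : P.IsBase Δ) (G : P.Good) {S : Finset V} (hS : S ⊆ Δ) {a b : V} (h : P.Linked S a b) :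
    P.Linked S b a := by
  unfold Linked at *
  induction h with
  | refl => exact Relation.ReflTransGen.refl
  | tail _ h ih =>
    refine Relation.ReflTransGen.head ⟨h.2.1, h.1, ?_⟩ ih
    intro h0
    exact h.2.2 (G.zero _ (hb.subset (hS h.2.1)) _ (hb.subset (hS h.1)) h0)

theorem component_conn (hb : P.IsBase Δ) (G : P.Good) {S : Finset V} (hS : S ⊆ Δ) {a : V} (ha : a ∈ S) :
    Conn P (P.component S a) := by
  refine ⟨⟨a, ?_⟩, ?_⟩
  · simp only [component, Finset.mem_filter]
    exact ⟨ha, Relation.ReflTransGen.refl⟩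
  · intro T hT hne h
    refine Finset.Subset.antisymm hT ?_
    obtain ⟨t, ht⟩ := hne
    intro c hc
    have ht' := Finset.mem_filter.1 (hT ht)
    have hc' := Finset.mem_filter.1 hc
    have hl : P.Linked S t c := (linked_symm_s14 hb G hS ht'.2).trans hc'.2
    clear hc hc'
    unfold Linked at hl
    induction hl with
    | refl => exact ht
    | tail _ h1 ih =>
      rename_i b c _
      by_contra hcT
      refine h1.2.2 (h b ih c ?_ hcT)
      have := Finset.mem_filter.1 (hT ih)
      simp only [component, Finset.mem_filter]
      exact ⟨h1.2.1, this.2.tail h1⟩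

theorem component_eq (hb : P.IsBase Δ) (G : P.Good) {S : Finset V} (hS : S ⊆ Δ) {a b c d : V}
    (hc : c ∈ P.component S a) (hd : d ∈ P.component S b) (h : P.pairInt c d ≠ 0) :
    P.component S a = P.component S b := by
  simp only [component, Finset.mem_filter] at hc hd
  have hab : P.Linked S a b := (hc.2.tail ⟨hc.1, hd.1, h⟩).trans (linked_symm_s14 hb G hS hd.2)
  ext e
  simp only [component, Finset.mem_filter]
  exact ⟨fun h => ⟨h.1, (linked_symm_s14 hb G hS hab).trans h.2⟩, fun h => ⟨h.1, hab.trans h.2⟩⟩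

theorem root_component (hb : P.IsBase Δ) (G : P.Good) {S : Finset V} (hS : S ⊆ Δ) :
    ∀ (m : ℕ) (α : V), ht Δ α = m → α ∈ P.roots → α ∈ cl S →
      ∃ a ∈ S, α ∈ cl (P.component S a) := by
  intro m
  induction m using Nat.strong_induction_on with
  | _ m IH =>
  intro α hm hα hp
  have hpΔ := cl_mono hS hp
  have hex : ∃ a ∈ Δ, 0 < (co Δ α a : ℤ) * P.pairInt a α := by
    by_contra hcon
    push Not at hcon
    have := Finset.sum_nonpos hcon
    rw [← pair_sum hb hα hα hpΔ, P.pair_self α hα] at this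
    omega
  obtain ⟨a, ha, hpos⟩ := hex
  have hca : 0 < co Δ α a := by
    rcases Nat.eq_zero_or_pos (co Δ α a) with h | h
    · rw [h] at hpos; simp at hpos
    · exact h
  have hpa : 0 < P.pairInt a α := by
    by_contra hcon
    push Not at hcon
    exact absurd hpos (not_lt.2 (mul_nonpos_of_nonneg_of_nonpos (by positivity) hcon))
  have haS : a ∈ S := by
    by_contra haS
    have := ((mem_cl_iff hb hS).1 hp).2 a ha haS
    omega
  have haR := hb.subset ha
  have hself : ∀ b ∈ S, b ∈ P.component S b := fun b hbS => by
    simp only [component, Finset.mem_filter]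
    exact ⟨hbS, Relation.ReflTransGen.refl⟩
  by_cases hne : a = α
  · exact ⟨a, haS, hne ▸ mem_cl (hself a haS)⟩
  have hr : α - a ∈ P.roots := by
    have := neg_mem_roots (G.sub a haR α hα hpa hne)
    rwa [neg_sub] at this
  have hβΔ : α - a ∈ cl Δ := by
    rcases hb.pos_or_neg _ hr with h | h
    · exact h
    · exfalso
      rw [neg_sub] at h
      -- a = α + (a - α)
      have h1 := ht_add hb hpΔ h
      have h2 : ht Δ a = 1 := by
        unfold ht
        rw [Finset.sum_congr rfl fun b hbΔ => co_single hb ha hbΔ]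
        simp [ha]
      rw [add_sub_cancel, h2] at h1
      have h3 : ht Δ α ≠ 0 := fun h => P.ne_zero α hα (eq_zero_of_ht hb hpΔ h)
      have h4 := eq_zero_of_ht hb h (by omega)
      exact hne (sub_eq_zero.1 h4)
  have hβS : α - a ∈ cl S := mem_of_add hb hS hβΔ (mem_cl ha) (by simpa using hp)
  have hlt : ht Δ (α - a) < m := by
    have h1 := ht_add hb hβΔ (mem_cl ha)
    rw [sub_add_cancel] at h1
    have h3 : ht Δ a ≠ 0 := fun h => P.ne_zero a haR (eq_zero_of_ht hb (mem_cl ha) h)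
    omega
  obtain ⟨b, hbS, hβ⟩ := IH _ hlt _ rfl hr hβS
  refine ⟨b, hbS, ?_⟩
  have hCS : P.component S b ⊆ S := Finset.filter_subset _ _
  by_cases haC : a ∈ P.component S b
  · have := add_mem hβ (mem_cl haC)
    simpa using this
  exfalso
  have h0 : P.pairInt (α - a) a = 0 := by
    refine pair_eq_zero hb (hCS.trans hS) haR hr hβ fun c hc => ?_
    by_contra hne0
    have := component_eq hb G hS hc (hself a haS) hne0
    exact haC (this ▸ hself a haS)
  have h2 : P.pairInt α a = 2 := by
    have := pair_add (P := P) haR hr haR (by simpa using hα)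
    rw [sub_add_cancel, h0, P.pair_self a haR] at this
    simpa using this
  have h3 := P.reflect_mem a haR α hα
  rw [h2] at h3
  refine sub_not_root hb (A := P.component S b) (B := {a}) (hCS.trans hS) (by simpa using ha)
    ?_ hβ (mem_cl (by simp)) (P.ne_zero _ hr) (P.ne_zero _ haR) ?_
  · intro c hc hca
    rw [Finset.mem_singleton] at hca
    exact haC (hca ▸ hc)
  · convert h3 using 1
    rw [two_zsmul]; abel

theorem cascadeAux_spec (hb : P.IsBase Δ) (G : P.Good) : ∀ (n : ℕ) (S : Finset V), S ⊆ Δ → S.card ≤ n →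
    (∀ K ∈ P.cascadeAux n S, K ⊆ S ∧ Conn P K) ∧
    (∀ α ∈ P.roots, α ∈ cl S →
      ∃ K ∈ P.cascadeAux n S, α ∈ cl K ∧ 0 < P.pairInt α (P.highestRoot K)) ∧
    (∀ K ∈ P.cascadeAux n S, ∀ K' ∈ P.cascadeAux n S, K ≠ K' →
      (∀ a ∈ K, P.pairInt a (P.highestRoot K') = 0) ∨
      (∀ a ∈ K', P.pairInt a (P.highestRoot K) = 0)) := by
  intro n
  induction n with
  | zero =>
    intro S _ hcard
    have hS0 : S = ∅ := by simpa using hcard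
    subst hS0
    refine ⟨by simp [cascadeAux], ?_, by simp [cascadeAux]⟩
    intro α hα hp
    simp only [cl, Finset.coe_empty, AddSubmonoid.closure_empty, AddSubmonoid.mem_bot] at hp
    exact absurd hp (P.ne_zero α hα)
  | succ n IH =>
    intro S hS hcard
    have hCS : ∀ a, P.component S a ⊆ S := fun a => Finset.filter_subset _ _
    have hzC : ∀ C, P.zeroPart C ⊆ C := fun C => Finset.filter_subset _ _
    have hM := fun a (ha : a ∈ S) =>
      hr_isMax hb G ((hCS a).trans hS) (component_conn hb G hS ha)
    have hz : ∀ a ∈ S, (P.zeroPart (P.component S a)).card ≤ n := by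
      intro a ha
      have hlt : (P.zeroPart (P.component S a)).card < (P.component S a).card := by
        refine Finset.card_lt_card ⟨hzC _, fun hsub => ?_⟩
        have h0 := pair_eq_zero hb ((hCS a).trans hS) (hM a ha).1.1 (hM a ha).1.1 (hM a ha).1.2.1
          (fun c hc => (Finset.mem_filter.1 (hsub hc)).2)
        rw [P.pair_self _ (hM a ha).1.1] at h0
        omega
      have := Finset.card_le_card (hCS a)
      omega
    have IH' := fun a (ha : a ∈ S) =>
      IH (P.zeroPart (P.component S a)) ((hzC _).trans ((hCS a).trans hS)) (hz a ha)
    have hmem : ∀ K, K ∈ P.cascadeAux (n + 1) S ↔ ∃ a ∈ S, K = P.component S a ∨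
        K ∈ P.cascadeAux n (P.zeroPart (P.component S a)) := by
      intro K
      simp [cascadeAux, components]
    have hsub : ∀ a ∈ S, ∀ K, (K = P.component S a ∨
        K ∈ P.cascadeAux n (P.zeroPart (P.component S a))) → K ⊆ P.component S a ∧ Conn P K := by
      rintro a ha K (rfl | hK)
      · exact ⟨subset_rfl, component_conn hb G hS ha⟩
      · exact ⟨((IH' a ha).1 K hK).1.trans (hzC _), ((IH' a ha).1 K hK).2⟩
    refine ⟨?_, ?_, ?_⟩
    · intro K hK
      obtain ⟨a, ha, h⟩ := (hmem K).1 hK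
      exact ⟨(hsub a ha K h).1.trans (hCS a), (hsub a ha K h).2⟩
    · intro α hα hp
      obtain ⟨a, ha, hαC⟩ := root_component hb G hS _ α rfl hα hp
      have hmax := (hM a ha).1
      have hC := (hCS a).trans hS
      have hnn := hmax.pair_nonneg hb G hC hα hαC
      rcases hnn.lt_or_eq with hlt | heq
      · exact ⟨_, (hmem _).2 ⟨a, ha, Or.inl rfl⟩, hαC, hlt⟩
      · have hαz : α ∈ cl (P.zeroPart (P.component S a)) := by
          rw [mem_cl_iff hb ((hzC _).trans hC)]
          have hαC' := (mem_cl_iff hb hC).1 hαC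
          refine ⟨hαC'.1, fun c hc hcz => ?_⟩
          by_cases hcC : c ∈ P.component S a
          · rw [pair_sum hb hmax.1 hα hαC'.1] at heq
            have h0 := (Finset.sum_eq_zero_iff_of_nonneg (by
              intro b hbΔ
              by_cases hbC : b ∈ P.component S a
              · exact mul_nonneg (by positivity)
                  (hmax.pair_nonneg hb G hC (hb.subset hbΔ) (mem_cl hbC))
              · rw [hαC'.2 b hbΔ hbC]; simp)).1 heq.symm c hc
            rcases mul_eq_zero.1 h0 with h | h
            · exact_mod_cast h
            · exact absurd (Finset.mem_filter.2 ⟨hcC, h⟩) hcz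
          · exact hαC'.2 c hc hcC
        obtain ⟨K, hK, h⟩ := (IH' a ha).2.1 α hα hαz
        exact ⟨K, (hmem K).2 ⟨a, ha, Or.inr hK⟩, h⟩
    · intro K hK K' hK' hne
      obtain ⟨a, ha, h⟩ := (hmem K).1 hK
      obtain ⟨a', ha', h'⟩ := (hmem K').1 hK'
      have hs := hsub a ha K h
      have hs' := hsub a' ha' K' h'
      by_cases hCC : P.component S a = P.component S a'
      · rw [← hCC] at h'
        rcases h with rfl | h
        · rcases h' with rfl | h'
          · exact absurd rfl hne
          · right
            intro b hbK
            exact (Finset.mem_filter.1 (((IH' a ha).1 K' h').1 hbK)).2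
        · rcases h' with rfl | h'
          · left
            intro b hbK
            exact (Finset.mem_filter.1 (((IH' a ha).1 K h).1 hbK)).2
          · exact (IH' a ha).2.2 K h K' h' hne
      · left
        intro b hbK
        have hK'Δ : K' ⊆ Δ := hs'.1.trans ((hCS a').trans hS)
        have hmax := (hr_isMax hb G hK'Δ hs'.2).1
        have hbR := hb.subset (hS (hCS a (hs.1 hbK)))
        refine G.zero _ hmax.1 _ hbR (pair_eq_zero hb hK'Δ hbR hmax.1 hmax.2.1 ?_)
        intro c hc
        by_contra hne0
        exact hCC (component_eq hb G hS (hs'.1 hc) (hs.1 hbK) hne0).symm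

theorem cascade_spec (hb : P.IsBase Δ) (G : P.Good) :
    (∀ K ∈ P.cascade Δ, IsMax P K (P.highestRoot K) ∧ K ⊆ Δ ∧
      ∀ α ∈ P.roots, α ∈ cl K → P.highestRoot K - α ∈ cl K) ∧
    (∀ α ∈ P.roots, α ∈ cl Δ →
      ∃ K ∈ P.cascade Δ, α ∈ cl K ∧ 0 < P.pairInt α (P.highestRoot K)) ∧
    (∀ K ∈ P.cascade Δ, ∀ K' ∈ P.cascade Δ, K ≠ K' →
      P.pairInt (P.highestRoot K) (P.highestRoot K') = 0) ∧
    (∀ K ∈ P.cascade Δ, ∀ K' ∈ P.cascade Δ, ∀ β ∈ P.roots, β ∈ cl Δ → ∀ α ∈ P.roots, α ∈ cl Δ →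
      ∀ α', α' ∈ P.roots ∨ α' = 0 → α' ∈ cl Δ → P.highestRoot K = α + β →
      P.highestRoot K' = α' + β → K = K') := by
  obtain ⟨h1, h2, h3⟩ := cascadeAux_spec hb G (Δ.card + 1) Δ subset_rfl (Nat.le_succ _)
  have hM : ∀ K ∈ P.cascade Δ, IsMax P K (P.highestRoot K) ∧ K ⊆ Δ ∧
      ∀ α ∈ P.roots, α ∈ cl K → P.highestRoot K - α ∈ cl K := fun K hK =>
    have := hr_isMax hb G (h1 K hK).1 (h1 K hK).2
    ⟨this.1, (h1 K hK).1, this.2⟩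
  refine ⟨hM, h2, ?_, ?_⟩
  · intro K hK K' hK' hne
    obtain ⟨m, hKΔ, -⟩ := hM K hK
    obtain ⟨m', hKΔ', -⟩ := hM K' hK'
    rcases h3 K hK K' hK' hne with h | h
    · exact pair_eq_zero hb hKΔ m'.1 m.1 m.2.1 h
    · exact G.zero _ m'.1 _ m.1 (pair_eq_zero hb hKΔ' m.1 m'.1 m'.2.1 h)
  · intro K hK K' hK' β hβ hβΔ α hα hαΔ α' hα' hαΔ' e e'
    have aux : ∀ K ∈ P.cascade Δ, ∀ α, α ∈ P.roots ∨ α = 0 → β ∈ cl K → 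
        P.highestRoot K = α + β → P.pairInt β (P.highestRoot K) = 0 → False := by
      intro K hK α hα hβK e h0
      obtain ⟨m, hKΔ, -⟩ := hM K hK
      rcases hα with hα | rfl
      · have hp := pair_add (P := P) m.1 hα hβ (e ▸ m.1)
        rw [← e, h0, P.pair_self _ m.1] at hp
        have hr := P.reflect_mem _ m.1 α hα
        rw [add_zero] at hp; rw [← hp] at hr
        refine m.add_not hb hKΔ hβ hβK ?_
        convert neg_mem_roots hr using 1
        rw [e, two_zsmul]; abel
      · rw [zero_add] at e
        rw [← e, P.pair_self _ m.1] at h0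
        omega
    by_contra hne
    obtain ⟨m, hKΔ, -⟩ := hM K hK
    obtain ⟨m', hKΔ', -⟩ := hM K' hK'
    have hβK : β ∈ cl K := mem_of_add hb hKΔ hβΔ hαΔ (by rw [add_comm, ← e]; exact m.2.1)
    have hβK' : β ∈ cl K' := mem_of_add hb hKΔ' hβΔ hαΔ' (by rw [add_comm, ← e']; exact m'.2.1)
    rcases h3 K hK K' hK' hne with h | h
    · exact aux K' hK' α' hα' hβK' e' (pair_eq_zero hb hKΔ m'.1 hβ hβK h)
    · exact aux K hK α (Or.inl hα) hβK e (pair_eq_zero hb hKΔ' m.1 hβ hβK' h)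

end base

end RootSystemData


section LieHelpers

open LieAlgebra LieAlgebra.IsKilling LieModule

variable {k g : Type*} [Field k] [CharZero k]
    [LieRing g] [LieAlgebra k g] [FiniteDimensional k g] [LieAlgebra.IsKilling k g]
    {H : LieSubalgebra k g} [H.IsCartanSubalgebra] [LieModule.IsTriangularizable k H g]

theorem cascadeLie_lie_mem {α β : Module.Dual k H} {x y : g} (hx : x ∈ rootSpace H ⇑α)
    (hy : y ∈ rootSpace H ⇑β) : ⁅x, y⁆ ∈ rootSpace H ⇑(α + β) :=
  lie_mem_genWeightSpace_of_mem_genWeightSpace hx hy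

theorem cascadeLie_proj (μ : H → k) : ∃ p : g →ₗ[k] g, (∀ v ∈ rootSpace H μ, p v = v) ∧
    ∀ ν, ν ≠ μ → ∀ v ∈ rootSpace H ν, p v = 0 := by
  have h1 := iSupIndep_genWeightSpace k H g μ
  have h2 := iSup_genWeightSpace_eq_top k H g
  have hc : IsCompl (genWeightSpace g μ) (⨆ ν, ⨆ (_ : ν ≠ μ), genWeightSpace g ν) := by
    refine ⟨h1, codisjoint_iff.2 ?_⟩
    rw [eq_top_iff, ← h2]
    refine iSup_le fun ν => ?_
    by_cases h : ν = μ
    · subst h; exact le_sup_left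
    · exact le_sup_of_le_right (le_iSup₂_of_le ν h le_rfl)
  have hc' := (LieSubmodule.isCompl_toSubmodule).2 hc
  refine ⟨Submodule.projection _ _ hc', ?_, ?_⟩
  · intro v hv
    exact (Submodule.projection_apply_left hc' ⟨v, hv⟩)
  · intro ν hν v hv
    have : v ∈ (⨆ ν, ⨆ (_ : ν ≠ μ), genWeightSpace g ν) :=
      (le_iSup₂_of_le (f := fun ν (_ : ν ≠ μ) => genWeightSpace g ν) ν hν le_rfl) hv
    exact (Submodule.projection_apply_eq_zero_iff hc').2 this

theorem cascadeLie_nonvanish {i : H.root} {α : H → k} {x f : g}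
    (hf : f ∈ rootSpace H (-⇑i.1)) (hf0 : f ≠ 0) (hx : x ∈ rootSpace H α)
    (hα : rootSpace H (⇑i.1 + α) = ⊥) (hp : α (coroot i.1) ≠ 0) (h0 : ⁅x, f⁆ = 0) : x = 0 := by
  have hi : i.1.IsNonZero := LieSubalgebra.isNonZero_coe_root i
  obtain ⟨h, e, f', t, he, hf'⟩ := exists_isSl2Triple_of_weight_isNonZero hi
  have hh := t.h_eq_coroot hi he hf'
  have hni : (-i.1).IsNonZero := by simpa using hi
  have hr := finrank_rootSpace_eq_one (-i.1) hni
  have hc : ∃ c : k, c • f = f' := by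
    obtain ⟨c, hc⟩ := (finrank_eq_one_iff_of_nonzero' (⟨f, by simpa using hf⟩ : rootSpace H ⇑(-i.1))
      (by simpa using hf0)).1 hr ⟨f', by simpa using hf'⟩
    exact ⟨c, congrArg Subtype.val hc⟩
  obtain ⟨c, rfl⟩ := hc
  have hex : ⁅e, x⁆ = 0 := by
    have := lie_mem_genWeightSpace_of_mem_genWeightSpace he hx
    change _ ∈ rootSpace H (⇑i.1 + α) at this
    rw [hα] at this
    simpa using this
  have hfx : ⁅c • f, x⁆ = 0 := by
    rw [smul_lie, ← lie_skew, h0]; simp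
  have hhx : ⁅h, x⁆ = 0 := by
    rw [← t.lie_e_f, lie_lie, hex, hfx]; simp
  have := lie_eq_smul_of_mem_rootSpace hx (coroot i.1)
  rw [LieSubalgebra.coe_bracket_of_module, ← hh, hhx] at this
  exact (smul_eq_zero.1 this.symm).resolve_left hp

section
variable {P : RootSystemData k (Module.Dual k H)}
  (hroots : ∀ α : Module.Dual k H, α ∈ P.roots ↔ α ≠ 0 ∧ rootSpace H ⇑α ≠ ⊥)

theorem cascadeLie_root (hroots : ∀ α : Module.Dual k H, α ∈ P.roots ↔ α ≠ 0 ∧ rootSpace H ⇑α ≠ ⊥)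
    {α : Module.Dual k H} (hα : α ∈ P.roots) : ∃ i : H.root, (rootSystem H).root i = α := by
  obtain ⟨h0, h1⟩ := (hroots α).1 hα
  refine ⟨⟨⟨⇑α, h1⟩, ?_⟩, ?_⟩
  · simp only [Finset.mem_filter, Finset.mem_univ, true_and]
    intro h
    apply h0
    ext x
    exact congrFun h x
  · ext x
    rfl

theorem cascadeLie_root_mem
    (hroots : ∀ α : Module.Dual k H, α ∈ P.roots ↔ α ≠ 0 ∧ rootSpace H ⇑α ≠ ⊥) (i : H.root) :
    (rootSystem H).root i ∈ P.roots := by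
  rw [hroots]
  exact ⟨(rootSystem H).ne_zero i, i.1.2⟩

theorem cascadeLie_roots_eq
    (hroots : ∀ α : Module.Dual k H, α ∈ P.roots ↔ α ≠ 0 ∧ rootSpace H ⇑α ≠ ⊥)  :
    (P.roots : Set (Module.Dual k H)) = Set.range (rootSystem H).root := by
  ext α
  constructor
  · intro h; exact cascadeLie_root hroots h
  · rintro ⟨i, rfl⟩; exact cascadeLie_root_mem hroots i

theorem cascadeLie_form
    (hroots : ∀ α : Module.Dual k H, α ∈ P.roots ↔ α ≠ 0 ∧ rootSpace H ⇑α ≠ ⊥) (i : H.root) :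
    P.corootForm ((rootSystem H).root i) = (rootSystem H).coroot' i := by
  have hi := cascadeLie_root_mem hroots i
  refine Module.Dual.eq_of_preReflection_mapsTo (x := (rootSystem H).root i)
    (Φ := (P.roots : Set (Module.Dual k H))) (P.roots.finite_toSet) P.span_eq_top ?_ ?_ ?_ ?_
  · rw [← P.pair_compat _ hi _ hi, P.pair_self _ hi]; norm_num
  · intro β hβ
    have := P.reflect_mem _ hi β hβ
    rw [Module.preReflection_apply, ← P.pair_compat _ hi _ hβ, Int.cast_smul_eq_zsmul]
    exact this
  · exact (rootSystem H).root_coroot'_eq_pairing i i ▸ (rootSystem H).pairing_same i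
  · rw [cascadeLie_roots_eq hroots]
    exact (rootSystem H).mapsTo_reflection_root i

theorem cascadeLie_pair
    (hroots : ∀ α : Module.Dual k H, α ∈ P.roots ↔ α ≠ 0 ∧ rootSpace H ⇑α ≠ ⊥) (i j : H.root) :
    (P.pairInt ((rootSystem H).root j) ((rootSystem H).root i) : k) = (rootSystem H).pairing j i := by
  rw [P.pair_compat _ (cascadeLie_root_mem hroots i) _ (cascadeLie_root_mem hroots j),
    cascadeLie_form hroots]
  exact (rootSystem H).root_coroot'_eq_pairing i j

theorem cascadeLie_pairIn
    (hroots : ∀ α : Module.Dual k H, α ∈ P.roots ↔ α ≠ 0 ∧ rootSpace H ⇑α ≠ ⊥) (i j : H.root) :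
    P.pairInt ((rootSystem H).root j) ((rootSystem H).root i) = (rootSystem H).pairingIn ℤ j i := by
  have := cascadeLie_pair hroots i j
  rw [← (rootSystem H).algebraMap_pairingIn ℤ] at this
  simpa using this

theorem cascadeLie_good
    (hroots : ∀ α : Module.Dual k H, α ∈ P.roots ↔ α ≠ 0 ∧ rootSpace H ⇑α ≠ ⊥) : P.Good := by
  refine ⟨?_, ?_, ?_⟩
  · intro α hα β hβ h hne
    obtain ⟨i, rfl⟩ := cascadeLie_root hroots hα
    obtain ⟨j, rfl⟩ := cascadeLie_root hroots hβ
    rw [cascadeLie_pairIn hroots] at h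
    obtain ⟨l, hl⟩ := (rootSystem H).root_sub_root_mem_of_pairingIn_pos h (by rintro rfl; exact hne rfl)
    rw [← hl]
    exact cascadeLie_root_mem hroots l
  · intro α hα β hβ h hne
    obtain ⟨i, rfl⟩ := cascadeLie_root hroots hα
    obtain ⟨j, rfl⟩ := cascadeLie_root hroots hβ
    rw [cascadeLie_pairIn hroots] at h
    obtain ⟨l, hl⟩ := (rootSystem H).root_add_root_mem_of_pairingIn_neg h hne
    rw [← hl]
    exact cascadeLie_root_mem hroots l
  · intro α hα β hβ h
    obtain ⟨i, rfl⟩ := cascadeLie_root hroots hα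
    obtain ⟨j, rfl⟩ := cascadeLie_root hroots hβ
    rw [cascadeLie_pairIn hroots] at h ⊢
    exact (rootSystem H).pairingIn_eq_zero_iff.1 h

end

end LieHelpers

section LieMain

open LieAlgebra LieAlgebra.IsKilling LieModule RootSystemData

variable {k g : Type*} [Field k] [CharZero k]
    [LieRing g] [LieAlgebra k g] [FiniteDimensional k g] [LieAlgebra.IsKilling k g]
    {H : LieSubalgebra k g} [H.IsCartanSubalgebra] [LieModule.IsTriangularizable k H g]

theorem cascadeLie_coroot {i : H.root} {e f : g}
    (he : e ∈ rootSpace H ⇑i.1) (hf : f ∈ rootSpace H (-⇑i.1)) :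
    ∃ c : k, ⁅e, f⁆ = ((c • coroot i.1 : H) : g) := by
  have h0 : ⁅e, f⁆ ∈ rootSpace H (⇑i.1 + -⇑i.1) :=
    lie_mem_genWeightSpace_of_mem_genWeightSpace he hf
  rw [add_neg_cancel, rootSpace_zero_eq] at h0
  have h0 : ⁅e, f⁆ ∈ H := h0
  have h1 : (⟨⁅e, f⁆, h0⟩ : H) ∈ corootSpace ⇑i.1 := by
    rw [mem_corootSpace]
    exact Submodule.subset_span ⟨e, he, f, hf, rfl⟩
  rw [← LieSubmodule.mem_toSubmodule, coe_corootSpace_eq_span_singleton,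
    Submodule.mem_span_singleton] at h1
  obtain ⟨c, hc⟩ := h1
  exact ⟨c, by rw [hc]⟩

theorem cascadeLie_main
    (P : RootSystemData k (Module.Dual k H))
    (hroots : ∀ α : Module.Dual k H, α ∈ P.roots ↔ α ≠ 0 ∧ rootSpace H ⇑α ≠ ⊥)
    (Δ : Finset (Module.Dual k H)) (hbase : P.IsBase Δ)
    (X : Module.Dual k H → g)
    (hX : ∀ α ∈ P.roots, X α ∈ rootSpace H ⇑α ∧ X α ≠ 0)
    (u : g) (hu : u = ∑ K ∈ P.cascade Δ, X (-P.highestRoot K))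
    (n : Submodule k g)
    (hn : n = ⨆ α ∈ P.posRoots Δ, (rootSpace H ⇑α).toSubmodule)
    (x : g) (hx : x ∈ H.toSubmodule ⊔ n) :
    (∃ hxH : x ∈ H, ∀ K ∈ P.cascade Δ, P.highestRoot K ⟨x, hxH⟩ = 0) ↔ ⁅x, u⁆ ∈ n := by
  have G := cascadeLie_good hroots
  obtain ⟨c1, c2, c3, c4⟩ := cascade_spec hbase G
  have hε : ∀ K ∈ P.cascade Δ, P.highestRoot K ∈ P.roots := fun K hK => (c1 K hK).1.1
  have hεΔ : ∀ K ∈ P.cascade Δ, P.highestRoot K ∈ cl Δ := fun K hK =>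
    cl_mono (c1 K hK).2.1 (c1 K hK).1.2.1
  have hXK : ∀ K ∈ P.cascade Δ, X (-P.highestRoot K) ∈ rootSpace H ⇑(-P.highestRoot K) ∧
      X (-P.highestRoot K) ≠ 0 := fun K hK => hX _ (neg_mem_roots (hε K hK))
  constructor
  · rintro ⟨hxH, h⟩
    have : ⁅x, u⁆ = 0 := by
      rw [hu, lie_sum]
      refine Finset.sum_eq_zero fun K hK => ?_
      have := lie_eq_smul_of_mem_rootSpace (hXK K hK).1 ⟨x, hxH⟩
      rw [LieSubalgebra.coe_bracket_of_module] at this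
      rw [this, LinearMap.neg_apply, h K hK, neg_zero, zero_smul]
    rw [this]
    exact zero_mem n
  · intro hxu
    obtain ⟨h, hh, y, hy, rfl⟩ := Submodule.mem_sup.1 hx
    rw [hn] at hy
    obtain ⟨y', rfl⟩ := (Submodule.mem_iSup_finset_iff_exists_sum _ _).1 hy
    have hpos : ∀ α, α ∈ P.posRoots Δ ↔ α ∈ P.roots ∧ α ∈ cl Δ := fun α => by
      simp [posRoots]
    have h0pos : (0 : Module.Dual k H) ∉ P.posRoots Δ := fun h =>
      P.ne_zero _ ((hpos 0).1 h).1 rfl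
    -- components
    obtain ⟨z, hz⟩ : ∃ z : Module.Dual k H → g, z = fun α => if α = 0 then h else (y' α : g) :=
      ⟨_, rfl⟩
    have hz0 : z 0 = h := by simp [hz]
    have hzα : ∀ α, α ∈ P.posRoots Δ → z α = y' α := by
      intro α hα
      rw [hz]
      exact if_neg (P.ne_zero _ ((hpos α).1 hα).1)
    have hsum : ∑ α ∈ insert 0 (P.posRoots Δ), z α = h + ∑ α ∈ P.posRoots Δ, (y' α : g) := by
      rw [Finset.sum_insert h0pos, hz0, Finset.sum_congr rfl hzα]
    have hzm : ∀ α ∈ insert 0 (P.posRoots Δ), z α ∈ rootSpace H ⇑α := by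
      intro α hα
      rcases Finset.mem_insert.1 hα with rfl | hα
      · rw [hz0]
        have : rootSpace H ⇑(0 : Module.Dual k H) = H.toLieSubmodule := rootSpace_zero_eq k g H
        rw [this]
        exact hh
      · rw [hzα α hα]
        exact (y' α).2
    have hins : ∀ α ∈ insert 0 (P.posRoots Δ), (α ∈ P.roots ∨ α = 0) ∧ α ∈ cl Δ := by
      intro α hα
      rcases Finset.mem_insert.1 hα with rfl | hα
      · exact ⟨Or.inr rfl, zero_mem _⟩
      · exact ⟨Or.inl ((hpos α).1 hα).1, ((hpos α).1 hα).2⟩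
    have key : ∀ μ : Module.Dual k H, μ ∉ P.posRoots Δ →
        ∑ A ∈ insert 0 (P.posRoots Δ), ∑ K ∈ P.cascade Δ,
          (if A - P.highestRoot K = μ then ⁅z A, X (-P.highestRoot K)⁆ else 0) = 0 := by
      intro μ hμ
      obtain ⟨p, hp1, hp2⟩ := cascadeLie_proj (H := H) ⇑μ
      have hpn : n ≤ LinearMap.ker p := by
        rw [hn]
        refine iSup₂_le fun α hα v hv => ?_
        refine hp2 _ ?_ v hv
        intro he
        exact hμ ((DFunLike.coe_injective he) ▸ hα)
      have := hpn hxu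
      rw [LinearMap.mem_ker, ← hsum, hu, sum_lie, map_sum] at this
      refine Eq.trans ?_ this
      refine Finset.sum_congr rfl fun A hA => ?_
      rw [lie_sum, map_sum]
      refine Finset.sum_congr rfl fun K hK => ?_
      have hm := cascadeLie_lie_mem (hzm A hA) (hXK K hK).1
      rw [← sub_eq_add_neg] at hm
      split_ifs with hc
      · rw [hc] at hm
        rw [hp1 _ hm]
      · rw [hp2 _ (fun he => hc (DFunLike.coe_injective he)) _ hm]
    -- one surviving term
    have single : ∀ A ∈ insert 0 (P.posRoots Δ), ∀ K ∈ P.cascade Δ,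
        A - P.highestRoot K ∉ P.posRoots Δ →
        (∀ A' ∈ insert 0 (P.posRoots Δ), ∀ K' ∈ P.cascade Δ,
          A' - P.highestRoot K' = A - P.highestRoot K → K' = K) →
        ⁅z A, X (-P.highestRoot K)⁆ = 0 := by
      intro A hA K hK hμ huniq
      rw [← key _ hμ, Finset.sum_eq_single A, Finset.sum_eq_single K]
      · rw [if_pos rfl]
      · intro K' hK' hne
        exact if_neg fun h => hne (huniq A hA K' hK' h)
      · intro h; exact absurd hK h
      · intro A' hA' hne
        refine Finset.sum_eq_zero fun K' hK' => if_neg fun h => hne ?_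
        have := huniq A' hA' K' hK' h
        subst this
        exact sub_left_injective h
      · intro h; exact absurd hA h
    have negpos : ∀ β ∈ P.roots, β ∈ cl Δ → -β ∉ P.posRoots Δ := by
      intro β hβ hβΔ h
      exact P.ne_zero β hβ (eq_zero_of_neg hbase hβΔ ((hpos _).1 h).2)
    -- the torus part
    have hH : ∀ K ∈ P.cascade Δ, P.highestRoot K ⟨h, hh⟩ = 0 := by
      intro K hK
      have h1 := single 0 (Finset.mem_insert_self _ _) K hK
        (by rw [zero_sub]; exact negpos _ (hε K hK) (hεΔ K hK)) (by
          intro A hA K' hK' he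
          rw [zero_sub] at he
          have he' : P.highestRoot K' = A + P.highestRoot K := by
            rw [sub_eq_iff_eq_add] at he
            rw [he]; abel
          rcases Finset.mem_insert.1 hA with rfl | hA
          · by_contra hne
            have h3 := c3 K' hK' K hK hne
            rw [he', zero_add, P.pair_self _ (hε K hK)] at h3
            omega
          · exact c4 K' hK' K hK _ (hε K hK) (hεΔ K hK) A ((hpos A).1 hA).1 ((hpos A).1 hA).2 0
              (Or.inr rfl) (zero_mem _) he' (zero_add _).symm)
      rw [hz0] at h1
      have := lie_eq_smul_of_mem_rootSpace (hXK K hK).1 ⟨h, hh⟩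
      rw [LieSubalgebra.coe_bracket_of_module] at this
      rw [h1] at this
      have := (smul_eq_zero.1 this.symm).resolve_right (hXK K hK).2
      rwa [LinearMap.neg_apply, neg_eq_zero] at this
    -- the nilpotent part
    have nonv : ∀ α ∈ P.roots, ∀ K ∈ P.cascade Δ, α ∈ cl K → 0 < P.pairInt α (P.highestRoot K) →
        ∀ v ∈ rootSpace H ⇑α, ⁅v, X (-P.highestRoot K)⁆ = 0 → v = 0 := by
      intro α hα K hK hαK hp v hv hv0
      obtain ⟨m, hKΔ, -⟩ := c1 K hK
      have hno := m.add_not hbase hKΔ hα hαK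
      obtain ⟨i, hi⟩ := cascadeLie_root hroots (hε K hK)
      obtain ⟨j, rfl⟩ := cascadeLie_root hroots hα
      have hXm := hXK K hK
      rw [← hi] at hXm hno hp hv0
      refine cascadeLie_nonvanish (i := i) hXm.1 hXm.2 hv ?_ ?_ hv0
      · by_contra hb
        apply hno
        rw [hroots]
        refine ⟨?_, ?_⟩
        · intro h0
          have := eq_zero_of_neg hbase (v := (rootSystem H).root j) (cl_mono hKΔ hαK) (by
            rw [neg_eq_of_add_eq_zero_right h0, hi]; exact hεΔ K hK)
          exact P.ne_zero _ hα this
        · rw [add_comm]; exact hb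
      · have h1 := cascadeLie_pair hroots i j
        rw [rootSystem_pairing_apply] at h1
        intro h2
        have h2 : j.1 (coroot i.1) = 0 := h2
        rw [h2] at h1
        have h1 : P.pairInt ((rootSystem H).root j) ((rootSystem H).root i) = 0 := by
          exact_mod_cast h1
        omega
    have hzero : ∑ K ∈ P.cascade Δ, ⁅z (P.highestRoot K), X (-P.highestRoot K)⁆ = 0 := by
      rw [← key 0 h0pos, Finset.sum_comm]
      refine Finset.sum_congr rfl fun K hK => ?_
      rw [Finset.sum_eq_single (P.highestRoot K)]
      · rw [if_pos (sub_self _)]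
      · intro A hA hne
        exact if_neg fun h => hne (sub_eq_zero.1 h)
      · intro h
        exact absurd (Finset.mem_insert_of_mem ((hpos _).2 ⟨hε K hK, hεΔ K hK⟩)) h
    have hzK : ∀ K ∈ P.cascade Δ, ⁅z (P.highestRoot K), X (-P.highestRoot K)⁆ = 0 := by
      rcases isEmpty_or_nonempty H.root with hemp | ⟨⟨i0⟩⟩
      · intro K hK
        exact isEmptyElim (cascadeLie_root hroots (hε K hK)).choose
      have hex : ∀ K, ∃ (c : k) (i : H.root), K ∈ P.cascade Δ →
          (rootSystem H).root i = P.highestRoot K ∧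
          ⁅z (P.highestRoot K), X (-P.highestRoot K)⁆ = ((c • coroot i.1 : H) : g) := by
        intro K
        by_cases hK : K ∈ P.cascade Δ
        · obtain ⟨i, hi⟩ := cascadeLie_root hroots (hε K hK)
          have hXm := (hXK K hK).1
          have hzm' := hzm _ (Finset.mem_insert_of_mem ((hpos _).2 ⟨hε K hK, hεΔ K hK⟩))
          rw [← hi] at hXm hzm'
          obtain ⟨c, hc⟩ := cascadeLie_coroot (i := i) hzm' hXm
          exact ⟨c, i, fun _ => ⟨hi, by rw [← hi]; exact hc⟩⟩
        · exact ⟨0, i0, fun h => absurd h hK⟩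
      choose c i hci using hex
      have hs : ∑ K ∈ P.cascade Δ, (c K • coroot (i K).1 : H) = 0 := by
        apply Subtype.ext
        rw [Finset.sum_congr rfl fun K hK => (hci K hK).2] at hzero
        push_cast at hzero ⊢
        exact hzero
      intro K hK
      have h1 := congrArg (P.highestRoot K) hs
      rw [map_sum, map_zero, Finset.sum_eq_single K] at h1
      · rw [map_smul, smul_eq_mul, ← (hci K hK).1] at h1
        have h2 : (rootSystem H).root (i K) (coroot (i K).1) = 2 :=
          (rootSystem H).pairing_same (i K)
        rw [h2] at h1
        have : c K = 0 := by simpa using h1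
        rw [(hci K hK).2, this, zero_smul]; rfl
      · intro K' hK' hne
        have h3 := cascadeLie_pair hroots (i K') (i K)
        rw [(hci K hK).1, (hci K' hK').1, c3 K hK K' hK' hne.symm] at h3
        have h4 : (rootSystem H).root (i K) (coroot (i K').1) = 0 := by
          rw [Int.cast_zero] at h3
          exact h3.symm
        rw [map_smul, ← (hci K hK).1, h4, smul_zero]
      · intro h; exact absurd hK h
    have hall : ∀ α ∈ P.posRoots Δ, z α = 0 := by
      intro α hα
      obtain ⟨hαr, hαΔ⟩ := (hpos α).1 hα
      have hαi : α ∈ insert 0 (P.posRoots Δ) := Finset.mem_insert_of_mem hα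
      obtain ⟨K, hK, hαK, hp⟩ := c2 α hαr hαΔ
      refine nonv α hαr K hK hαK hp _ (hzm α hαi) ?_
      by_cases he : α = P.highestRoot K
      · rw [he]; exact hzK K hK
      · have hβ := G.sub α hαr _ (hε K hK) hp he
        have hβ' := neg_mem_roots hβ
        rw [neg_sub] at hβ'
        have hβΔ := cl_mono (c1 K hK).2.1 ((c1 K hK).2.2 α hαr hαK)
        refine single α hαi K hK ?_ ?_
        · rw [← neg_sub]
          exact negpos _ hβ' hβΔ
        · intro A hA K' hK' h
          refine (c4 K hK K' hK' _ hβ' hβΔ α hαr hαΔ A (hins A hA).1 (hins A hA).2 (by abel) ?_).symm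
          rw [← neg_sub α, ← h]; abel
    have hx0 : h + ∑ α ∈ P.posRoots Δ, (y' α : g) = h := by
      rw [← hsum, Finset.sum_insert h0pos, Finset.sum_eq_zero hall, hz0, add_zero]
    refine ⟨by rw [hx0]; exact hh, fun K hK => ?_⟩
    have : (⟨h + ∑ α ∈ P.posRoots Δ, (y' α : g), by rw [hx0]; exact hh⟩ : H) = ⟨h, hh⟩ :=
      Subtype.ext hx0
    rw [this]
    exact hH K hK

end LieMain

section LieTheory

open LieAlgebra

/-- Let `𝔤` be a finite-dimensional semisimple Lie algebra over an
algebraically closed field `k` of characteristic `0`, with Cartan subalgebra `𝔥`, root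
system `R ⊆ 𝔥*`, base `Π`, positive roots `R₊`, `𝔫 = ⊕_{α ∈ R₊} 𝔤^α` and `𝔟 = 𝔥 ⊕ 𝔫`.
Fix nonzero root vectors `X_α ∈ 𝔤^α` for all `α ∈ R` and set `u = Σ_{K ∈ 𝒦} X_{-ε_K}`
where `𝒦 = 𝒦(Π)`.  Then for `x ∈ 𝔟` the following are equivalent:
(i) `x ∈ 𝔥` and `ε_K x = 0` for all `K ∈ 𝒦`;  (ii) `⁅x, u⁆ ∈ 𝔫`. -/
theorem mem_cartan_and_highest_roots_vanish_iff_bracket_mem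
    (k g : Type*) [Field k] [IsAlgClosed k] [CharZero k]
    [LieRing g] [LieAlgebra k g] [FiniteDimensional k g] [LieAlgebra.IsSemisimple k g]
    (H : LieSubalgebra k g) [H.IsCartanSubalgebra]
    (P : RootSystemData k (Module.Dual k H))
    (hroots : ∀ α : Module.Dual k H, α ∈ P.roots ↔ α ≠ 0 ∧ rootSpace H ⇑α ≠ ⊥)
    (Δ : Finset (Module.Dual k H)) (hbase : P.IsBase Δ)
    (X : Module.Dual k H → g)
    (hX : ∀ α ∈ P.roots, X α ∈ rootSpace H ⇑α ∧ X α ≠ 0)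
    (u : g) (hu : u = ∑ K ∈ P.cascade Δ, X (-P.highestRoot K))
    (n : Submodule k g)
    (hn : n = ⨆ α ∈ P.posRoots Δ, (rootSpace H ⇑α).toSubmodule)
    (x : g) (hx : x ∈ H.toSubmodule ⊔ n) :
    (∃ hxH : x ∈ H, ∀ K ∈ P.cascade Δ, P.highestRoot K ⟨x, hxH⟩ = 0) ↔ ⁅x, u⁆ ∈ n := by
  have : LieAlgebra.IsKilling k g := inferInstance
  exact cascadeLie_main P hroots Δ hbase X hX u hu n hn x hx

end LieTheory
end
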